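/- arXiv:2409.16131 — 4 statements merged into one kernel-verified Lean document; each statement's English description precedes it below -/
import Mathlib

section
/- Let X = {t_1 > t_2 > … > t_k} ⊆ [n]. Then the concatenation w_{t_1} ++ w_{t_2} ++ … ++ w_{t_k} is a reduced word; its product x lies in ᴵW and satisfies ∅·x = X. In particular, the element of ᴵW corresponding to X has Coxeter length t_1 + t_2 + … + t_k. -/
open List

/-- The Coxeter matrix of type `Bₙ` with the 4-bond between `s₀` and `s₁`. -/
def BCox (n : ℕ) : CoxeterMatrix (Fin n) where
  M := Matrix.of fun i j : Fin n ↦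
    if i = j then 1
      else if (i : ℕ) + (j : ℕ) = 1 then 4
      else if (j : ℕ) + 1 = (i : ℕ) ∨ (i : ℕ) + 1 = (j : ℕ) then 3 else 2
  isSymm := by
    unfold Matrix.IsSymm
    ext i j
    simp only [Matrix.transpose_apply, Matrix.of_apply]
    rcases eq_or_ne i j with h | h
    · subst h; simp
    · rw [if_neg h, if_neg (Ne.symm h)]
      split_ifs <;> omega
  diagonal := by simp
  off_diagonal := by
    intro i j hij
    simp only [Matrix.of_apply, if_neg hij]
    split_ifs <;> simp

/-- The right action of the generator `sᵢ` on subsets of `{1, …, n}`: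
`s₀` toggles membership of `1`; for `i ≥ 1`, `sᵢ` interchanges the membership
status of `i` and `i + 1`. -/
def bAct (n : ℕ) (X : Finset ℕ) (i : Fin n) : Finset ℕ :=
  if (i : ℕ) = 0 then (if 1 ∈ X then X.erase 1 else insert 1 X)
  else if (i : ℕ) ∈ X ∧ (i : ℕ) + 1 ∉ X then insert ((i : ℕ) + 1) (X.erase (i : ℕ))
  else if (i : ℕ) + 1 ∈ X ∧ (i : ℕ) ∉ X then insert (i : ℕ) (X.erase ((i : ℕ) + 1))
  else X

/-- The set `ᴵW` of minimal length representatives of the cosets `W_I∖W`,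
where `I = {s₁, …, s_{n−1}}`. -/
def IWset {n : ℕ} {W : Type*} [Group W] (cs : CoxeterSystem (BCox n) W) : Set W :=
  {x | ∀ i : Fin n, (i : ℕ) ≠ 0 → cs.length x < cs.length (cs.simple i * x)}

/-- `x` corresponds to the subset `X ⊆ {1, …, n}` under the bijection `ᴵW ≅ 𝒫([n])`;
that is, `X = ∅ · x` for the right action of `W` on subsets. -/
def corr {n : ℕ} {W : Type*} [Group W] (cs : CoxeterSystem (BCox n) W) (x : W)
    (X : Finset ℕ) : Prop :=
  ∃ w : List (Fin n), cs.wordProd w = x ∧ w.foldl (bAct n) ∅ = X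

/-- The word `w_a = (s₀, s₁, …, s_{a−1})`. -/
def rowWord (n a : ℕ) : List (Fin n) :=
  (List.range a).filterMap fun j => if h : j < n then some (⟨j, h⟩ : Fin n) else none

theorem mem_bAct (n : ℕ) (X : Finset ℕ) (i : Fin n) (k : ℕ) :
    k ∈ bAct n X i ↔ if (i : ℕ) = 0 then (if k = 1 then 1 ∉ X else k ∈ X)
      else if k = i then (i : ℕ) + 1 ∈ X else if k = i + 1 then (i : ℕ) ∈ X else k ∈ X := by
  unfold bAct
  split_ifs <;> (try simp only [Finset.mem_insert, Finset.mem_erase]) <;> grind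

theorem bAct_invol (n : ℕ) (i : Fin n) : Function.Involutive (fun X => bAct n X i) := by
  intro X
  ext k
  simp only [mem_bAct]
  grind

/-- The generator as a permutation of finsets. -/
def bPerm (n : ℕ) (i : Fin n) : Equiv.Perm (Finset ℕ) := (bAct_invol n i).toPerm

theorem bPerm_apply (n : ℕ) (i : Fin n) (X : Finset ℕ) : bPerm n i X = bAct n X i := rfl

theorem bPerm_liftable (n : ℕ) : (BCox n).IsLiftable (bPerm n) := by
  intro i j
  change (bPerm n i * bPerm n j) ^ (if i = j then 1
      else if (i : ℕ) + (j : ℕ) = 1 then 4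
      else if (j : ℕ) + 1 = (i : ℕ) ∨ (i : ℕ) + 1 = (j : ℕ) then 3 else 2) = 1
  split_ifs with h1 h2 h3
  · subst h1
    ext X : 1
    rw [pow_one]
    exact bAct_invol n i X
  · have h1' : (i : ℕ) ≠ j := fun h => h1 (Fin.ext h)
    have : ((i : ℕ) = 0 ∧ (j : ℕ) = 1) ∨ ((i : ℕ) = 1 ∧ (j : ℕ) = 0) := by omega
    ext X k
    simp only [pow_succ, pow_zero, one_mul, Equiv.Perm.mul_apply, Equiv.Perm.one_apply, bPerm_apply]
    rcases this with ⟨h, h'⟩ | ⟨h, h'⟩ <;>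
    · simp only [mem_bAct, h, h']
      by_cases k1 : k = 1
      · subst k1; simp
      · by_cases k2 : k = 2
        · subst k2; simp
        · simp [k1, k2]
  · have h1' : (i : ℕ) ≠ j := fun h => h1 (Fin.ext h)
    ext X k
    simp only [pow_succ, pow_zero, one_mul, Equiv.Perm.mul_apply, Equiv.Perm.one_apply, bPerm_apply]
    have hi : (i : ℕ) ≠ 0 := by omega
    have hj : (j : ℕ) ≠ 0 := by omega
    simp only [mem_bAct, hi, hj, if_false]
    rcases h3 with h | h
    · rw [← h]
      generalize (j : ℕ) = a at *
      have e1 : a + 1 + 1 ≠ a := by omega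
      by_cases k1 : k = a
      · subst k1; simp [e1, e1.symm]
      · by_cases k2 : k = a + 1
        · subst k2; simp [e1, e1.symm]
        · by_cases k3 : k = a + 1 + 1
          · subst k3; simp [e1, e1.symm]
          · simp [k1, k2, k3]
    · rw [← h]
      generalize (i : ℕ) = a at *
      have e1 : a + 1 + 1 ≠ a := by omega
      by_cases k1 : k = a
      · subst k1; simp [e1, e1.symm]
      · by_cases k2 : k = a + 1
        · subst k2; simp [e1, e1.symm]
        · by_cases k3 : k = a + 1 + 1
          · subst k3; simp [e1, e1.symm]
          · simp [k1, k2, k3]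
  · have h1' : (i : ℕ) ≠ j := fun h => h1 (Fin.ext h)
    ext X k
    simp only [pow_succ, pow_zero, one_mul, Equiv.Perm.mul_apply, Equiv.Perm.one_apply, bPerm_apply]
    simp only [mem_bAct]
    generalize (i : ℕ) = a at *
    generalize (j : ℕ) = b at *
    grind

theorem foldl_eq_lift {n : ℕ} {W : Type*} [Group W] (cs : CoxeterSystem (BCox n) W)
    (w : List (Fin n)) (X : Finset ℕ) :
    w.foldl (bAct n) X = cs.lift ⟨bPerm n, bPerm_liftable n⟩ (cs.wordProd w)⁻¹ X := by
  induction w generalizing X with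
  | nil => simp
  | cons a w ih =>
    rw [List.foldl_cons, ih, cs.wordProd_cons, mul_inv_rev, map_mul, Equiv.Perm.mul_apply,
      cs.inv_simple, cs.lift_apply_simple (bPerm_liftable n)]
    rfl

theorem sum_bAct_le (n : ℕ) (X : Finset ℕ) (i : Fin n) :
    (bAct n X i).sum (fun x => x) ≤ X.sum (fun x => x) + 1 := by
  unfold bAct
  split_ifs with h0 h1 h2 h3
  · have := Finset.sum_erase_add X (fun x => x) h1
    omega
  · rw [Finset.sum_insert h1]; omega
  · have := Finset.sum_erase_add X (fun x => x) h2.1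
    rw [Finset.sum_insert (by simp [h2.2])]
    omega
  · have := Finset.sum_erase_add X (fun x => x) h3.1
    rw [Finset.sum_insert (by simp [h3.2])]
    omega
  · omega

theorem sum_foldl_le (n : ℕ) (w : List (Fin n)) (X : Finset ℕ) :
    (w.foldl (bAct n) X).sum (fun x => x) ≤ X.sum (fun x => x) + w.length := by
  induction w generalizing X with
  | nil => simp
  | cons a w ih =>
    have h1 := ih (bAct n X a)
    have h2 := sum_bAct_le n X a
    simp only [List.foldl_cons, List.length_cons]
    omega

theorem sum_foldl_le_length {n : ℕ} {W : Type*} [Group W] (cs : CoxeterSystem (BCox n) W)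
    (w : List (Fin n)) :
    (w.foldl (bAct n) ∅).sum (fun x => x) ≤ cs.length (cs.wordProd w) := by
  obtain ⟨v, hv, hp⟩ := cs.exists_isReduced (cs.wordProd w)
  rw [foldl_eq_lift cs, hp, ← foldl_eq_lift cs, hv]
  simpa using sum_foldl_le n v ∅

theorem rowWord_succ {n t : ℕ} (h : t < n) : rowWord n (t + 1) = rowWord n t ++ [⟨t, h⟩] := by
  simp [rowWord, List.range_succ, List.filterMap_append, h]

theorem length_rowWord {n t : ℕ} (h : t ≤ n) : (rowWord n t).length = t := by
  induction t with
  | zero => rfl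
  | succ t ih => rw [rowWord_succ h, List.length_append, ih (by omega)]; rfl

theorem foldl_rowWord {n t : ℕ} (h : t + 1 ≤ n) (X : Finset ℕ) (hX : ∀ x ∈ X, t + 1 < x) :
    (rowWord n (t + 1)).foldl (bAct n) X = insert (t + 1) X := by
  induction t with
  | zero =>
    have : 1 ∉ X := fun h => by simpa using hX 1 h
    rw [rowWord_succ h]
    simp [rowWord, bAct, this]
  | succ t ih =>
    rw [rowWord_succ h, List.foldl_append, ih (by omega) (fun x hx => by have := hX x hx; omega)]
    have h1 : t + 1 ∉ X := fun h => by have := hX _ h; omega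
    have h2 : t + 1 + 1 ∉ X := fun h => by have := hX _ h; omega
    simp [bAct, h1, h2]

theorem foldl_rows {n : ℕ} (T : List ℕ) (hT : T.Pairwise (· > ·))
    (hmem : ∀ t ∈ T, t ∈ Finset.Icc 1 n) (X : Finset ℕ) (hX : ∀ x ∈ X, ∀ t ∈ T, t < x) :
    ((T.map (rowWord n)).flatten).foldl (bAct n) X = X ∪ T.toFinset := by
  induction T generalizing X with
  | nil => simp
  | cons a T ih =>
    rw [List.pairwise_cons] at hT
    have ha := hmem a (by simp)
    rw [Finset.mem_Icc] at ha
    obtain ⟨b, rfl⟩ : ∃ b, a = b + 1 := ⟨a - 1, by omega⟩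
    rw [List.map_cons, List.flatten_cons, List.foldl_append,
      foldl_rowWord ha.2 X (fun x hx => hX x hx _ (by simp)),
      ih hT.2 (fun t ht => hmem t (by simp [ht]))]
    · ext k; simp
    · intro x hx t ht
      rcases Finset.mem_insert.1 hx with rfl | hx
      · exact hT.1 t ht
      · exact hX x hx t (by simp [ht])

theorem length_rows {n : ℕ} (T : List ℕ) (hmem : ∀ t ∈ T, t ∈ Finset.Icc 1 n) :
    ((T.map (rowWord n)).flatten).length = T.sum := by
  induction T with
  | nil => rfl
  | cons a T ih =>
    rw [List.map_cons, List.flatten_cons, List.length_append,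
      length_rowWord (Finset.mem_Icc.1 (hmem a (by simp))).2,
      ih (fun t ht => hmem t (by simp [ht])), List.sum_cons]

/-- Let `X = {t₁ > t₂ > … > t_k} ⊆ [n]`. Then the concatenation
`w_{t₁} ++ w_{t₂} ++ … ++ w_{t_k}` is a reduced word; its product `x` lies in `ᴵW` and
satisfies `∅·x = X`. In particular, the element of `ᴵW` corresponding to `X` has Coxeter
length `t₁ + t₂ + … + t_k`. -/
theorem stmt_2 (n : ℕ) (hn : 2 ≤ n) {W : Type*} [Group W] (cs : CoxeterSystem (BCox n) W)
    (T : List ℕ) (hT : T.Chain' (· > ·)) (hmem : ∀ t ∈ T, t ∈ Finset.Icc 1 n) :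
    cs.IsReduced ((T.map (rowWord n)).flatten) ∧
    cs.wordProd ((T.map (rowWord n)).flatten) ∈ IWset cs ∧
    corr cs (cs.wordProd ((T.map (rowWord n)).flatten)) T.toFinset ∧
    cs.length (cs.wordProd ((T.map (rowWord n)).flatten)) = T.sum := by
  have hP : T.Pairwise (· > ·) := List.isChain_iff_pairwise.1 hT
  have hlen := length_rows T hmem
  have hfold := foldl_rows T hP hmem ∅ (by simp)
  rw [Finset.empty_union] at hfold
  have hsum : T.toFinset.sum (fun x => x) = T.sum := by
    rw [List.sum_toFinset (fun x => x) (hP.imp (fun h => ne_of_gt h))]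
    simp
  generalize (T.map (rowWord n)).flatten = w at *
  have hle := cs.length_wordProd_le w
  have hge := sum_foldl_le_length cs w
  rw [hfold, hsum] at hge
  have hL : cs.length (cs.wordProd w) = T.sum := by omega
  refine ⟨by rw [CoxeterSystem.IsReduced]; omega, ?_, ⟨w, rfl, hfold⟩, hL⟩
  intro i hi
  have h1 := sum_foldl_le_length cs (i :: w)
  have h2 : bAct n ∅ i = ∅ := by simp [bAct, hi]
  rw [List.foldl_cons, h2, hfold, hsum, cs.wordProd_cons] at h1
  have h3 := cs.length_simple_mul_ne (cs.wordProd w) i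
  omega
end

section
/- Let X = {t_1 > … > t_k} ⊆ [n] and let x be the element of ᴵW corresponding to X. Then the column reduced expression of X is a reduced word whose product is x; moreover it can be obtained from the row word w_{t_1} ++ w_{t_2} ++ … ++ w_{t_k} by a finite sequence of exchanges of adjacent letters s_a, s_b with |a − b| ≥ 2. -/
open List

/-- The boxes `(i, c)` (row `i`, 0-based; column `c`, 1-based) of the shifted tableau of the
strictly decreasing list `T`, listed column by column from left to right and, within each
column, from top to bottom. Row `i` occupies the columns `2i + 1, …, 2i + T[i]`. -/
def boxes (T : List ℕ) : List (ℕ × ℕ) :=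
  (List.range' 1 (2 * T.length + T.headD 0)).flatMap fun c =>
    (List.range T.length).filterMap fun i =>
      if 2 * i < c ∧ c ≤ 2 * i + T.getD i 0 then some (i, c) else none

/-- The column reduced expression of `T`: reading the labels of the shifted tableau column by
column from left to right and, within each column, from top to bottom; the box of row `i` in
column `c` carries the label `c − 2i − 1`. -/
def colWord (n : ℕ) (T : List ℕ) : List (Fin n) :=
  (boxes T).filterMap fun b =>
    if h : b.2 - 2 * b.1 - 1 < n then some (⟨b.2 - 2 * b.1 - 1, h⟩ : Fin n) else none

/-- A single exchange of two adjacent letters `s_a`, `s_b` with `|a − b| ≥ 2`. -/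
def CommSwap (n : ℕ) (w w' : List (Fin n)) : Prop :=
  ∃ (u v : List (Fin n)) (a b : Fin n),
    ((a : ℕ) + 2 ≤ (b : ℕ) ∨ (b : ℕ) + 2 ≤ (a : ℕ)) ∧
    w = u ++ a :: b :: v ∧ w' = u ++ b :: a :: v


namespace Bn

variable {n : ℕ} {W : Type*} [Group W] (cs : CoxeterSystem (BCox n) W)

/-! ### Commutation classes -/

theorem CommSwap.cons {w w' : List (Fin n)} (p : Fin n) (h : CommSwap n w w') :
    CommSwap n (p :: w) (p :: w') := by
  obtain ⟨u, v, a, b, hab, rfl, rfl⟩ := h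
  exact ⟨p :: u, v, a, b, hab, rfl, rfl⟩

theorem rtg_cons {w w' : List (Fin n)} (p : Fin n)
    (h : Relation.ReflTransGen (CommSwap n) w w') :
    Relation.ReflTransGen (CommSwap n) (p :: w) (p :: w') := by
  induction h with
  | refl => exact .refl
  | tail _ h ih => exact ih.tail (CommSwap.cons p h)

theorem move_front (p : Fin n) (u v : List (Fin n))
    (h : ∀ q ∈ u, (p : ℕ) + 2 ≤ (q : ℕ) ∨ (q : ℕ) + 2 ≤ (p : ℕ)) :
    Relation.ReflTransGen (CommSwap n) (p :: (u ++ v)) (u ++ p :: v) := by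
  induction u with
  | nil => exact .refl
  | cons q u ih =>
    refine Relation.ReflTransGen.head (b := q :: p :: (u ++ v)) ?_ ?_
    · exact ⟨[], u ++ v, p, q, h q (by simp), rfl, rfl⟩
    · exact rtg_cons q (ih fun r hr => h r (by simp [hr]))

theorem trace_lemma {α : Type*} (f : α → Option (Fin n)) (r₁ r₂ : α → α → Prop)
    (L₁ L₂ : List α) (h₁ : L₁.Pairwise r₁) (h₂ : L₂.Pairwise r₂) (hp : L₁.Perm L₂)
    (hc : ∀ a ∈ L₁, ∀ b ∈ L₁, r₁ a b → r₂ b a → ∀ p q, f a = some p → f b = some q →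
      ((p : ℕ) + 2 ≤ (q : ℕ) ∨ (q : ℕ) + 2 ≤ (p : ℕ))) :
    Relation.ReflTransGen (CommSwap n) (L₁.filterMap f) (L₂.filterMap f) := by
  induction L₁ generalizing L₂ with
  | nil =>
    have : L₂ = [] := by simpa using hp.symm
    subst this; exact .refl
  | cons a L ih =>
    have ha : a ∈ L₂ := hp.subset (by simp)
    obtain ⟨u, v, rfl⟩ := List.append_of_mem ha
    have hp' : L.Perm (u ++ v) := by
      have := hp.trans List.perm_middle
      exact (List.perm_cons a).1 this
    rw [List.pairwise_cons] at h₁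
    have h₂' : (u ++ v).Pairwise r₂ := h₂.sublist (by simp)
    have hi := ih (u ++ v) h₁.2 h₂' hp' fun b hb c hc' => hc b (by simp [hb]) c (by simp [hc'])
    rcases hfa : f a with _ | p
    · simpa [List.filterMap_cons, hfa] using hi
    · have := rtg_cons p hi
      rw [List.filterMap_append, List.filterMap_cons, List.filterMap_cons, hfa]
      rw [List.filterMap_append] at this
      refine this.trans (move_front p _ _ ?_)
      intro q hq
      obtain ⟨b, hb, hbq⟩ := List.mem_filterMap.1 hq
      have hbL : b ∈ L := hp'.symm.subset (by simp [hb])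
      refine hc a (by simp) b (by simp [hbL]) (h₁.1 b hbL) ?_ p q hfa hbq
      exact (List.pairwise_append.1 h₂).2.2 b hb a (by simp)

/-- The boxes of the tableau row by row. -/
def rboxes (T : List ℕ) : List (ℕ × ℕ) :=
  (List.range T.length).flatMap fun i => (List.range (T.getD i 0)).map fun j => (i, 2 * i + 1 + j)

def lab (n : ℕ) (b : ℕ × ℕ) : Option (Fin n) :=
  if h : b.2 - 2 * b.1 - 1 < n then some (⟨b.2 - 2 * b.1 - 1, h⟩ : Fin n) else none

theorem rboxes_word (T : List ℕ) :
    (rboxes T).filterMap (lab n) = (T.map (rowWord n)).flatten := by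
  have hT : T = (List.range T.length).map (fun i => T.getD i 0) := by
    apply List.ext_getElem <;> simp +contextual
  conv_rhs => rw [hT]
  unfold rboxes
  rw [List.filterMap_flatMap, List.map_map, ← List.flatMap_def]
  congr 1
  funext i
  simp only [Function.comp, rowWord, List.filterMap_map]
  congr 1
  funext j
  have : 2 * i + 1 + j - 2 * i - 1 = j := by omega
  simp [lab, this]

def r1 (a b : ℕ × ℕ) : Prop := a.1 < b.1 ∨ (a.1 = b.1 ∧ a.2 < b.2)
def r2 (a b : ℕ × ℕ) : Prop := a.2 < b.2 ∨ (a.2 = b.2 ∧ a.1 < b.1)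

theorem pw_rboxes (T : List ℕ) : (rboxes T).Pairwise r1 := by
  unfold rboxes
  rw [List.pairwise_flatMap]
  constructor
  · intro i _
    rw [List.pairwise_map]
    refine List.pairwise_lt_range.imp ?_
    intro a b h; right; simp; omega
  · refine List.pairwise_lt_range.imp ?_
    intro i j h x hx y hy
    simp only [List.mem_map, List.mem_range] at hx hy
    obtain ⟨_, _, rfl⟩ := hx
    obtain ⟨_, _, rfl⟩ := hy
    left; exact h

theorem pw_boxes (T : List ℕ) : (boxes T).Pairwise r2 := by
  unfold boxes
  rw [List.pairwise_flatMap]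
  constructor
  · intro c _
    rw [List.pairwise_filterMap]
    refine List.pairwise_lt_range.imp ?_
    intro a b h x hx y hy
    split_ifs at hx hy <;> simp_all
    subst hx; subst hy
    right; simp; omega
  · refine (List.pairwise_lt_range' 1).imp ?_
    intro i j h x hx y hy
    simp only [List.mem_filterMap, List.mem_range] at hx hy
    obtain ⟨_, _, hx⟩ := hx
    obtain ⟨_, _, hy⟩ := hy
    split_ifs at hx hy <;> simp_all
    subst hx; subst hy
    left; exact h

theorem mem_rboxes (T : List ℕ) (b : ℕ × ℕ) :
    b ∈ rboxes T ↔ b.1 < T.length ∧ 2 * b.1 < b.2 ∧ b.2 ≤ 2 * b.1 + T.getD b.1 0 := by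
  obtain ⟨i, c⟩ := b
  simp only [rboxes, List.mem_flatMap, List.mem_map, List.mem_range, Prod.mk.injEq]
  constructor
  · rintro ⟨_, h, j, hj, rfl, rfl⟩
    refine ⟨h, ?_, ?_⟩ <;> omega
  · rintro ⟨h1, h2, h3⟩
    exact ⟨i, h1, c - 2 * i - 1, by omega, rfl, by omega⟩

theorem getD_le_head (T : List ℕ) (hT : T.Pairwise (· > ·)) (i : ℕ) :
    T.getD i 0 ≤ T.headD 0 := by
  rcases T with _ | ⟨a, T⟩
  · simp
  · rcases i with _ | i
    · simp
    · rw [List.pairwise_cons] at hT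
      simp only [List.getD_cons_succ, List.headD_cons]
      by_cases h : i < T.length
      · rw [List.getD_eq_getElem _ _ h]
        exact (hT.1 _ (List.getElem_mem h)).le
      · rw [List.getD_eq_default _ _ (by omega)]; omega

theorem mem_boxes (T : List ℕ) (hT : T.Pairwise (· > ·)) (b : ℕ × ℕ) :
    b ∈ boxes T ↔ b.1 < T.length ∧ 2 * b.1 < b.2 ∧ b.2 ≤ 2 * b.1 + T.getD b.1 0 := by
  obtain ⟨i, c⟩ := b
  simp only [boxes, List.mem_flatMap, List.mem_filterMap, List.mem_range, List.mem_range'_1]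
  constructor
  · rintro ⟨c', hc, j, hj, h⟩
    split_ifs at h with h'
    simp only [Option.some.injEq, Prod.mk.injEq] at h
    obtain ⟨rfl, rfl⟩ := h
    exact ⟨hj, h'⟩
  · rintro ⟨h1, h2, h3⟩
    have := getD_le_head T hT i
    refine ⟨c, ⟨by omega, by omega⟩, i, h1, ?_⟩
    rw [if_pos ⟨h2, h3⟩]

theorem rtg_main (n : ℕ) (T : List ℕ) (hT : T.Pairwise (· > ·)) :
    Relation.ReflTransGen (CommSwap n) ((T.map (rowWord n)).flatten) (colWord n T) := by
  rw [← rboxes_word]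
  refine trace_lemma (lab n) r1 r2 _ _ (pw_rboxes T) (pw_boxes T) ?_ ?_
  · rw [List.perm_ext_iff_of_nodup]
    · intro b; rw [mem_rboxes, mem_boxes _ hT]
    · exact (pw_rboxes T).imp (by rintro a _ h rfl; simp [r1] at h)
    · exact (pw_boxes T).imp (by rintro a _ h rfl; simp [r2] at h)
  · intro a ha b hb h1 h2 p q hp hq
    rw [mem_rboxes] at ha hb
    simp only [lab] at hp hq
    split_ifs at hp hq
    simp only [Option.some.injEq] at hp hq
    subst hp; subst hq
    simp only [r1, r2] at h1 h2
    simp only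
    omega

/-! ### The action -/

theorem mem_bAct (X : Finset ℕ) (i : Fin n) (k : ℕ) :
    k ∈ bAct n X i ↔ if (i : ℕ) = 0 then (if k = 1 then 1 ∉ X else k ∈ X)
      else (if k = i then (i : ℕ) + 1 ∈ X else if k = i + 1 then (i : ℕ) ∈ X else k ∈ X) := by
  unfold bAct
  grind

theorem bAct_bAct (X : Finset ℕ) (i : Fin n) : bAct n (bAct n X i) i = X := by
  ext k
  simp only [mem_bAct]
  grind

/-- The generator as a permutation of the finsets. -/
def bPerm (i : Fin n) : Equiv.Perm (Finset ℕ) where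
  toFun X := bAct n X i
  invFun X := bAct n X i
  left_inv X := bAct_bAct X i
  right_inv X := bAct_bAct X i

theorem bPerm_lift : (BCox n).IsLiftable (fun i : Fin n => MulOpposite.op (bPerm i)) := by
  intro i j
  rw [← MulOpposite.op_mul, ← MulOpposite.op_pow, ← MulOpposite.op_one]
  congr 1
  ext X k
  simp only [BCox, CoxeterMatrix.M, Matrix.of_apply]
  have hi := i.2
  have hj := j.2
  split_ifs with h1 h2 h3
  · subst h1
    simp [bPerm, bAct_bAct]
  · simp [pow_succ, bPerm, mem_bAct]
    grind
  · simp [pow_succ, bPerm, mem_bAct]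
    grind
  · simp [pow_succ, bPerm, mem_bAct]
    grind

theorem foldl_eq (w : List (Fin n)) (X : Finset ℕ) :
    w.foldl (bAct n) X =
      (cs.lift ⟨_, bPerm_lift⟩ (cs.wordProd w)).unop X := by
  induction w generalizing X with
  | nil => simp
  | cons i w ih =>
    rw [List.foldl_cons, ih, cs.wordProd_cons, map_mul, MulOpposite.unop_mul, Equiv.Perm.mul_apply,
      cs.lift_apply_simple]
    rfl

end Bn

namespace Bn

variable {n : ℕ} {W : Type*} [Group W] (cs : CoxeterSystem (BCox n) W)

/-! ### Generators indexed by naturals, row elements -/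

/-- `s_j`, with junk value `1` for `j ≥ n`. -/
def sN (j : ℕ) : W := if h : j < n then cs.simple ⟨j, h⟩ else 1

theorem sN_sq (j : ℕ) : sN cs j * sN cs j = 1 := by
  unfold sN; split_ifs <;> simp

theorem sN_inv (j : ℕ) : (sN cs j)⁻¹ = sN cs j := by
  rw [inv_eq_iff_mul_eq_one, sN_sq]

theorem sN_comm (i j : ℕ) (h : i + 2 ≤ j) : sN cs i * sN cs j = sN cs j * sN cs i := by
  unfold sN
  split_ifs with h1 h2
  · have := cs.simple_mul_simple_pow ⟨i, h1⟩ ⟨j, h2⟩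
    have hM : (BCox n) ⟨i, h1⟩ ⟨j, h2⟩ = 2 := by
      change (BCox n).M _ _ = 2
      simp only [BCox, Matrix.of_apply, Fin.mk.injEq]
      split_ifs <;> omega
    rw [hM, pow_two, ← eq_inv_iff_mul_eq_one, mul_inv_rev, cs.inv_simple, cs.inv_simple] at this
    exact this
  all_goals simp

theorem sN_comm' (i j : ℕ) (h : i + 2 ≤ j ∨ j + 2 ≤ i) :
    sN cs i * sN cs j = sN cs j * sN cs i := by
  rcases h with h | h
  · exact sN_comm cs i j h
  · exact (sN_comm cs j i h).symm

theorem sN_braid (i : ℕ) (hi : 1 ≤ i) (h : i + 1 < n) :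
    sN cs i * sN cs (i + 1) * sN cs i = sN cs (i + 1) * sN cs i * sN cs (i + 1) := by
  have h0 : i < n := by omega
  have e1 : sN cs i = cs.simple ⟨i, h0⟩ := by simp [sN, h0]
  have e2 : sN cs (i + 1) = cs.simple ⟨i + 1, h⟩ := by simp [sN, h]
  have := cs.simple_mul_simple_pow ⟨i, h0⟩ ⟨i + 1, h⟩
  have hM : (BCox n) ⟨i, h0⟩ ⟨i + 1, h⟩ = 3 := by
    change (BCox n).M _ _ = 3
    simp only [BCox, Matrix.of_apply, Fin.mk.injEq]
    rw [if_neg (by omega), if_neg (by omega), if_pos (Or.inr trivial)]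
  rw [hM, ← e1, ← e2] at this
  have h3 : (sN cs i * sN cs (i + 1) * sN cs i) * (sN cs (i + 1) * sN cs i * sN cs (i + 1)) = 1 := by
    rw [← this]; simp only [pow_succ, pow_zero, one_mul, mul_assoc]
  rw [← eq_inv_iff_mul_eq_one] at h3
  rw [h3]
  simp only [mul_inv_rev, sN_inv, mul_assoc]

theorem sN_braid4 (h : 1 < n) :
    sN cs 0 * sN cs 1 * sN cs 0 * sN cs 1 = sN cs 1 * sN cs 0 * sN cs 1 * sN cs 0 := by
  have h0 : 0 < n := by omega
  have e1 : sN cs 0 = cs.simple ⟨0, h0⟩ := by simp [sN, h0]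
  have e2 : sN cs 1 = cs.simple ⟨1, h⟩ := by simp [sN, h]
  have := cs.simple_mul_simple_pow ⟨0, h0⟩ ⟨1, h⟩
  have hM : (BCox n) ⟨0, h0⟩ ⟨1, h⟩ = 4 := by
    change (BCox n).M _ _ = 4
    simp [BCox]
  rw [hM, ← e1, ← e2] at this
  have h3 : (sN cs 0 * sN cs 1 * sN cs 0 * sN cs 1) *
      (sN cs 0 * sN cs 1 * sN cs 0 * sN cs 1) = 1 := by
    rw [← this]; simp only [pow_succ, pow_zero, one_mul, mul_assoc]
  rw [← eq_inv_iff_mul_eq_one] at h3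
  rw [h3]
  simp only [mul_inv_rev, sN_inv, mul_assoc]

/-- The element `s_0 s_1 ⋯ s_{t-1}`. -/
def wt : ℕ → W
  | 0 => 1
  | t + 1 => wt t * sN cs t

/-- `y(R)` for an ascending list. -/
def y : List ℕ → W
  | [] => 1
  | t :: R => y R * wt cs t

theorem wt_high (t i : ℕ) (h : t < i) : wt cs t * sN cs i = sN cs i * wt cs t := by
  induction t with
  | zero => simp [wt]
  | succ t ih =>
    rw [wt, mul_assoc, sN_comm cs t i (by omega), ← mul_assoc, ih (by omega), mul_assoc]

theorem wt_low (t i : ℕ) (hi : 1 ≤ i) (h : i + 2 ≤ t) (ht : t ≤ n) :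
    wt cs t * sN cs i = sN cs (i + 1) * wt cs t := by
  induction t with
  | zero => omega
  | succ t ih =>
    rcases Nat.lt_or_ge t (i + 2) with h' | h'
    · obtain rfl : t = i + 1 := by omega
      have e : wt cs (i + 1 + 1) * sN cs i
          = wt cs i * (sN cs i * sN cs (i + 1) * sN cs i) := by
        simp only [wt, mul_assoc]
      rw [e, sN_braid cs i hi (by omega)]
      simp only [wt, ← mul_assoc]
      rw [wt_high cs i (i + 1) (by omega)]
    · rw [wt, mul_assoc, ← sN_comm cs i t (by omega), ← mul_assoc, ih h' (by omega), mul_assoc]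

theorem wt_double (t : ℕ) (h1 : 1 ≤ t) (ht : t + 1 ≤ n) :
    wt cs (t + 1) * wt cs t * sN cs t = sN cs 1 * (wt cs (t + 1) * wt cs t) := by
  induction t with
  | zero => omega
  | succ t ih =>
    rcases Nat.eq_zero_or_pos t with rfl | h0
    · have := sN_braid4 cs (by omega)
      simp only [wt, one_mul, zero_add, mul_assoc] at this ⊢
      exact this
    · have c : sN cs (t + 1) * wt cs t = wt cs t * sN cs (t + 1) :=
        (wt_high cs t (t + 1) (by omega)).symm
      have e : wt cs (t + 1 + 1) * wt cs (t + 1) =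
          wt cs (t + 1) * wt cs t * (sN cs (t + 1) * sN cs t) := by
        have : wt cs (t + 1 + 1) * wt cs (t + 1) =
          wt cs (t + 1) * (sN cs (t + 1) * wt cs t) * sN cs t := by
            rw [wt]
            conv_lhs => rw [show wt cs (t + 1) = wt cs t * sN cs t from rfl]
            conv_rhs => rw [show wt cs (t + 1) = wt cs t * sN cs t from rfl]
            simp only [mul_assoc]
        rw [this, c]; simp only [mul_assoc]
      rw [e, mul_assoc, ← sN_braid cs t h0 (by omega), mul_assoc (sN cs t),
        ← mul_assoc _ (sN cs t), ih h0 (by omega)]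
      simp only [mul_assoc]

theorem y_low (R : List ℕ) (i : ℕ) (hi : 1 ≤ i) (hin : i < n) (hR : R.Pairwise (· < ·))
    (hb : ∀ t ∈ R, i + 2 ≤ t ∧ t ≤ n) :
    ∃ j, 1 ≤ j ∧ j < n ∧ y cs R * sN cs i = sN cs j * y cs R := by
  induction R generalizing i with
  | nil => exact ⟨i, hi, hin, by simp [y]⟩
  | cons t R ih =>
    rw [List.pairwise_cons] at hR
    have ht := hb t (by simp)
    obtain ⟨j, hj, hjn, e⟩ := ih (i + 1) (by omega) (by omega) hR.2 (by
      intro u hu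
      have := hR.1 u hu
      have := hb u (by simp [hu])
      omega)
    refine ⟨j, hj, hjn, ?_⟩
    rw [y, mul_assoc, wt_low cs t i hi ht.1 ht.2, ← mul_assoc, e, mul_assoc]

/-- Ascending lists with entries in `[1, n]`. -/
def Good (n : ℕ) (R : List ℕ) : Prop := R.Pairwise (· < ·) ∧ ∀ t ∈ R, 1 ≤ t ∧ t ≤ n

theorem y_step (R : List ℕ) (i : Fin n) (hR : Good n R) :
    (∃ R', Good n R' ∧ R'.toFinset = bAct n R.toFinset i ∧ R'.sum ≤ R.sum + 1 ∧
      y cs R * sN cs i = y cs R') ∨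
    (bAct n R.toFinset i = R.toFinset ∧
      ∃ j, 1 ≤ j ∧ j < n ∧ y cs R * sN cs i = sN cs j * y cs R) := by
  have hin := i.2
  induction R with
  | nil =>
    by_cases hi : (i : ℕ) = 0
    · left
      refine ⟨[1], ?_, ?_, by simp, ?_⟩
      · simp [Good]; omega
      · ext k; rw [mem_bAct]; simp [hi]
      · simp [y, wt, hi]
    · right
      refine ⟨?_, i, by omega, hin, by simp [y]⟩
      ext k; rw [mem_bAct]; simp [hi]
  | cons t R ih =>
    obtain ⟨hp, hb⟩ := hR
    rw [List.pairwise_cons] at hp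
    have ht := hb t (by simp)
    have hb' : ∀ u ∈ R, t < u ∧ u ≤ n := fun u hu => ⟨hp.1 u hu, (hb u (by simp [hu])).2⟩
    have hG : Good n R := ⟨hp.2, fun u hu => hb u (by simp [hu])⟩
    by_cases hi : (i : ℕ) = 0
    · left
      by_cases h1 : t = 1
      · refine ⟨R, hG, ?_, by simp; omega, ?_⟩
        · ext k; rw [mem_bAct]
          have : k ∈ R → t < k := fun h => (hb' k h).1
          simp only [List.mem_toFinset, List.mem_cons, hi]
          grind
        · rw [hi, h1, y, mul_assoc]; simp [wt, sN_sq]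
      · refine ⟨1 :: t :: R, ⟨?_, ?_⟩, ?_, by simp; omega, ?_⟩
        · simp only [List.pairwise_cons, List.mem_cons]
          refine ⟨?_, hp⟩
          rintro u (rfl | hu)
          · omega
          · have := hb' u hu; omega
        · intro u hu
          rcases List.mem_cons.1 hu with rfl | hu
          · omega
          · exact hb u hu
        · ext k; rw [mem_bAct]
          have : k ∈ R → t < k := fun h => (hb' k h).1
          have : 1 ∈ R → t < 1 := fun h => (hb' 1 h).1
          simp only [List.mem_toFinset, List.mem_cons, hi]
          grind
        · rw [hi]; simp [y, wt]
    rcases lt_trichotomy (i : ℕ) t with hit | hit | hit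
    · by_cases hit' : (i : ℕ) + 1 = t
      · left
        refine ⟨i :: R, ⟨?_, ?_⟩, ?_, by simp; omega, ?_⟩
        · rw [List.pairwise_cons]
          exact ⟨fun u hu => by have := hb' u hu; omega, hp.2⟩
        · intro u hu
          rcases List.mem_cons.1 hu with rfl | hu
          · omega
          · exact hG.2 u hu
        · ext k; rw [mem_bAct]
          have : k ∈ R → t < k := fun h => (hb' k h).1
          have : (i : ℕ) ∈ R → t < i := fun h => (hb' i h).1
          simp only [List.mem_toFinset, List.mem_cons]
          grind
        · rw [← hit', y, y, wt, mul_assoc, mul_assoc, sN_sq, mul_one]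
      · right
        refine ⟨?_, y_low cs _ i (by omega) hin (List.pairwise_cons.2 hp) ?_⟩
        · ext k; rw [mem_bAct]
          have : k ∈ R → t < k := fun h => (hb' k h).1
          have : (i : ℕ) ∈ R → t < i := fun h => (hb' i h).1
          have : (i : ℕ) + 1 ∈ R → t < i + 1 := fun h => (hb' _ h).1
          simp only [List.mem_toFinset, List.mem_cons]
          grind
        · intro u hu
          rcases List.mem_cons.1 hu with rfl | hu
          · omega
          · have := hb' u hu; omega
    · by_cases hm : t + 1 ∈ R
      · right
        constructor
        · ext k; rw [mem_bAct]
          simp only [List.mem_toFinset, List.mem_cons]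
          grind
        · rcases R with _ | ⟨u, R⟩
          · simp at hm
          · have hp2 := List.pairwise_cons.1 hp.2
            have hu : u = t + 1 := by
              have h1 := hb' u (by simp)
              rcases List.mem_cons.1 hm with h | h
              · exact h.symm
              · have := hp2.1 _ h; omega
            subst hu
            obtain ⟨j, hj, hjn, e⟩ := y_low cs R 1 le_rfl (by omega) hp2.2 (by
              intro u hu
              have := hp2.1 u hu
              have := hb' u (by simp [hu])
              omega)
            refine ⟨j, hj, hjn, ?_⟩
            have d := wt_double cs t ht.1 (by omega)
            rw [hit]
            simp only [y]
            rw [mul_assoc, mul_assoc, ← mul_assoc (wt cs (t + 1)), d, ← mul_assoc, e]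
            simp only [mul_assoc]
      · left
        refine ⟨(t + 1) :: R, ⟨?_, ?_⟩, ?_, by simp; omega, ?_⟩
        · rw [List.pairwise_cons]
          refine ⟨fun u hu => ?_, hp.2⟩
          have := hb' u hu
          have : u ≠ t + 1 := by rintro rfl; exact hm hu
          omega
        · intro u hu
          rcases List.mem_cons.1 hu with rfl | hu
          · omega
          · exact hG.2 u hu
        · ext k; rw [mem_bAct]
          have : k ∈ R → t < k := fun h => (hb' k h).1
          simp only [List.mem_toFinset, List.mem_cons]
          grind
        · rw [hit, y, y, wt, mul_assoc]
    · have e : y cs (t :: R) * sN cs i = y cs R * sN cs i * wt cs t := by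
        rw [y, mul_assoc, wt_high cs t i hit, ← mul_assoc]
      have hX : ∀ Y : Finset ℕ, bAct n R.toFinset i = Y →
          bAct n (t :: R).toFinset i = insert t Y := by
        rintro Y rfl
        ext k
        rw [Finset.mem_insert, mem_bAct, mem_bAct]
        simp only [List.mem_toFinset, List.mem_cons]
        grind
      rcases ih hG with ⟨R', hG', hR', hs, e'⟩ | ⟨h1, j, hj, hjn, e'⟩
      · left
        refine ⟨t :: R', ⟨?_, ?_⟩, ?_, by simp; omega, ?_⟩
        · rw [List.pairwise_cons]
          refine ⟨fun u hu => ?_, hG'.1⟩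
          have hu' : u ∈ bAct n R.toFinset i := by rw [← hR']; simpa using hu
          rw [mem_bAct] at hu'
          have : u ∈ R → t < u := fun h => (hb' u h).1
          simp only [List.mem_toFinset] at hu'
          grind
        · intro u hu
          rcases List.mem_cons.1 hu with rfl | hu
          · exact ht
          · exact hG'.2 u hu
        · rw [hX _ hR'.symm, List.toFinset_cons]
        · rw [e, e', y]
      · right
        refine ⟨?_, j, hj, hjn, ?_⟩
        · rw [hX _ h1, List.toFinset_cons]
        · rw [e, e', y, mul_assoc]

theorem wordProd_decomp (w : List (Fin n)) :
    ∃ (v : List (Fin n)) (R : List ℕ), Good n R ∧ (∀ j ∈ v, (j : ℕ) ≠ 0) ∧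
      R.toFinset = w.foldl (bAct n) ∅ ∧ v.length + R.sum ≤ w.length ∧
      cs.wordProd w = cs.wordProd v * y cs R := by
  induction w using List.reverseRecOn with
  | nil => exact ⟨[], [], by simp [Good], by simp, by simp, by simp, by simp [y]⟩
  | append_singleton w i ih =>
    obtain ⟨v, R, hG, hv, hR, hl, e⟩ := ih
    have hs : sN cs i = cs.simple i := by simp [sN]
    rw [List.foldl_append, ← hR, cs.wordProd_append, e, cs.wordProd_singleton, ← hs, mul_assoc]
    simp only [List.foldl_cons, List.foldl_nil, List.length_append, List.length_singleton]
    rcases y_step cs R i hG with ⟨R', hG', hR', hs', e'⟩ | ⟨h1, j, hj, hjn, e'⟩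
    · exact ⟨v, R', hG', hv, hR', by omega, by rw [e']⟩
    · refine ⟨v ++ [⟨j, hjn⟩], R, hG, ?_, h1.symm, by simp; omega, ?_⟩
      · intro k hk
        rcases List.mem_append.1 hk with hk | hk
        · exact hv k hk
        · simp at hk; subst hk; simp; omega
      · rw [e', cs.wordProd_append, cs.wordProd_singleton, ← mul_assoc]
        simp [sN, hjn]

theorem rowWord_succ (t : ℕ) (h : t < n) : rowWord n (t + 1) = rowWord n t ++ [⟨t, h⟩] := by
  simp [rowWord, List.range_succ, List.filterMap_append, h]

theorem rowWord_prod (t : ℕ) (h : t ≤ n) :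
    cs.wordProd (rowWord n t) = wt cs t ∧ (rowWord n t).length = t := by
  induction t with
  | zero => simp [rowWord, wt]
  | succ t ih =>
    obtain ⟨h1, h2⟩ := ih (by omega)
    rw [rowWord_succ t h, cs.wordProd_append, h1, cs.wordProd_singleton, wt]
    have : t < n := h
    simp [sN, this, h2]

theorem rows_prod (R : List ℕ) (h : ∀ t ∈ R, t ≤ n) :
    cs.wordProd ((R.reverse.map (rowWord n)).flatten) = y cs R ∧
      ((R.reverse.map (rowWord n)).flatten).length = R.sum := by
  induction R with
  | nil => simp [y]
  | cons t R ih =>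
    obtain ⟨h1, h2⟩ := ih fun u hu => h u (by simp [hu])
    obtain ⟨h3, h4⟩ := rowWord_prod cs t (h t (by simp))
    rw [List.reverse_cons, List.map_append, List.flatten_append, cs.wordProd_append, h1,
      List.length_append, h2]
    simp [y, h3, h4, add_comm]

theorem swap_inv {w w' : List (Fin n)} (h : Relation.ReflTransGen (CommSwap n) w w') :
    cs.wordProd w = cs.wordProd w' ∧ w.length = w'.length := by
  induction h with
  | refl => simp
  | tail _ h ih =>
    obtain ⟨u, v, a, b, hab, rfl, rfl⟩ := h
    rw [ih.1, ih.2]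
    refine ⟨?_, by simp⟩
    have := sN_comm' cs a b hab
    simp only [sN, a.2, b.2, dite_true, Fin.eta] at this
    simp only [cs.wordProd_append, cs.wordProd_cons]
    rw [← mul_assoc (cs.simple a), this, mul_assoc]

end Bn

/-- Let `X = {t₁ > … > t_k} ⊆ [n]` and let `x` be the element of `ᴵW`
corresponding to `X`. Then the column reduced expression of `X` is a reduced word whose
product is `x`; moreover it can be obtained from the row word `w_{t₁} ++ … ++ w_{t_k}` by a
finite sequence of exchanges of adjacent letters `s_a, s_b` with `|a − b| ≥ 2`. -/
theorem stmt_3 (n : ℕ) (hn : 2 ≤ n) {W : Type*} [Group W] (cs : CoxeterSystem (BCox n) W)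
    (T : List ℕ) (hT : T.Chain' (· > ·)) (hmem : ∀ t ∈ T, t ∈ Finset.Icc 1 n)
    (x : W) (hx : x ∈ IWset cs) (hcorr : corr cs x T.toFinset) :
    cs.IsReduced (colWord n T) ∧
    cs.wordProd (colWord n T) = x ∧
    Relation.ReflTransGen (CommSwap n) ((T.map (rowWord n)).flatten) (colWord n T) := by
  have hP : T.Pairwise (· > ·) := List.isChain_iff_pairwise.1 hT
  have hrt := Bn.rtg_main n T hP
  obtain ⟨w, hw, hwT⟩ := hcorr
  obtain ⟨w', hred, hw'⟩ := cs.exists_isReduced x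
  obtain ⟨v, R, hG, hv, hR, hl, e⟩ := Bn.wordProd_decomp cs w'
  have hRT : R.toFinset = T.toFinset := by
    rw [hR, Bn.foldl_eq cs, ← hw', ← hw, ← Bn.foldl_eq cs, hwT]
  have hTR : R.reverse = T := by
    have h1 : R.reverse.Pairwise (· > ·) := List.pairwise_reverse.2 hG.1
    refine List.Perm.eq_of_pairwise (le := (· > ·)) (fun a b _ _ h h' => absurd h (lt_asymm h')) h1 hP ?_
    rw [List.perm_ext_iff_of_nodup (h1.imp fun h => ne_of_gt h) (hP.imp fun h => ne_of_gt h)]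
    intro a
    have := Finset.ext_iff.1 hRT a
    simpa using this
  have hrows := Bn.rows_prod cs R fun t ht => (hG.2 t ht).2
  rw [hTR] at hrows
  have hlen : cs.length x = w'.length := by rw [hw']; exact hred
  have hle : cs.length (Bn.y cs R) ≤ R.sum := by
    rw [← hrows.1, ← hrows.2]; exact cs.length_wordProd_le _
  have hv0 : v = [] := by
    rcases v with _ | ⟨j, v⟩
    · rfl
    · exfalso
      have h1 := hx j (hv j (by simp))
      rw [← hw', cs.wordProd_cons] at e
      have h2 : cs.simple j * x = cs.wordProd v * Bn.y cs R := by
        rw [e, mul_assoc, cs.simple_mul_simple_cancel_left]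
      have h3 := cs.length_mul_le (cs.wordProd v) (Bn.y cs R)
      have h4 := cs.length_wordProd_le v
      rw [← h2] at h3
      simp only [List.length_cons] at hl
      omega
  subst hv0
  rw [← hw', cs.wordProd_nil, one_mul] at e
  have hsw := Bn.swap_inv cs hrt
  have hprod : cs.wordProd (colWord n T) = x := by rw [← hsw.1, hrows.1, e]
  refine ⟨?_, hprod, hrt⟩
  have h5 := cs.length_wordProd_le (colWord n T)
  unfold CoxeterSystem.IsReduced
  rw [hprod] at h5 ⊢
  rw [← hsw.2, hrows.2] at h5 ⊢
  simp only [List.length_nil] at hl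
  omega
end

section
/- Let x, y ∈ ᴵW correspond to the subsets X = {t_1 > … > t_k} and Y = {u_1 > … > u_l} of [n]. Then y ≤ x in the Bruhat order on W if and only if l ≤ k and u_j ≤ t_j for every 1 ≤ j ≤ l. That is, under the bijection ᴵW ≅ 𝒫([n]), the Bruhat order on ᴵW corresponds to the containment order on strict partitions with largest part at most n. -/
open List

/-- The Bruhat order on `W`: `y ≤ x` if and only if some (equivalently, any) reduced word
for `x` admits a subword whose product is `y`. -/
def BruhatLE {n : ℕ} {W : Type*} [Group W] (cs : CoxeterSystem (BCox n) W) (y x : W) : Prop :=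
  ∃ w : List (Fin n), cs.IsReduced w ∧ cs.wordProd w = x ∧
    ∃ w' : List (Fin n), w'.Sublist w ∧ cs.wordProd w' = y

namespace B9

theorem mem_bAct {n : ℕ} (X : Finset ℕ) (i : Fin n) (j : ℕ) : j ∈ bAct n X i ↔
    if (i : ℕ) = 0 then (if j = 1 then 1 ∉ X else j ∈ X)
    else if j = i then (i : ℕ) + 1 ∈ X else if j = (i : ℕ) + 1 then (i : ℕ) ∈ X else j ∈ X := by
  unfold bAct
  grind

theorem bAct_bAct {n : ℕ} (X : Finset ℕ) (i : Fin n) : bAct n (bAct n X i) i = X := by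
  ext j; simp only [mem_bAct]; grind

theorem bAct_comm {n : ℕ} (X : Finset ℕ) (i k : Fin n) (h : (i : ℕ) + 1 < k) :
    bAct n (bAct n X i) k = bAct n (bAct n X k) i := by
  ext j; simp only [mem_bAct]; grind

theorem bAct_braid3 {n : ℕ} (X : Finset ℕ) (i k : Fin n) (h0 : (i : ℕ) ≠ 0)
    (h : (i : ℕ) + 1 = k) :
    bAct n (bAct n (bAct n X i) k) i = bAct n (bAct n (bAct n X k) i) k := by
  ext j; simp only [mem_bAct]; grind

theorem bAct_braid4 {n : ℕ} (X : Finset ℕ) (i k : Fin n) (h0 : (i : ℕ) = 0)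
    (h : (k : ℕ) = 1) :
    bAct n (bAct n (bAct n (bAct n X i) k) i) k = bAct n (bAct n (bAct n (bAct n X k) i) k) i := by
  ext j; simp only [mem_bAct, h0, h]; grind

theorem M_eq {n : ℕ} (i j : Fin n) : (BCox n).M i j = if i = j then 1
      else if (i : ℕ) + (j : ℕ) = 1 then 4
      else if (j : ℕ) + 1 = (i : ℕ) ∨ (i : ℕ) + 1 = (j : ℕ) then 3 else 2 := rfl

/-- the action as an element of the opposite endomorphism monoid -/
def act (n : ℕ) (i : Fin n) : (Function.End (Finset ℕ))ᵐᵒᵖ := MulOpposite.op (fun X ↦ bAct n X i)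

theorem act_liftable (n : ℕ) : (BCox n).IsLiftable (act n) := by
  intro i j
  apply MulOpposite.unop_injective
  funext X
  rw [M_eq]
  split_ifs with h1 h2 h3
  · subst h1
    exact bAct_bAct X i
  · show bAct n (bAct n (bAct n (bAct n (bAct n (bAct n (bAct n (bAct n X i) j) i) j) i) j) i) j = X
    have H : ∀ X, bAct n (bAct n (bAct n (bAct n X i) j) i) j
        = bAct n (bAct n (bAct n (bAct n X j) i) j) i := by
      intro X
      rcases (by omega : ((i : ℕ) = 0 ∧ (j : ℕ) = 1) ∨ ((j : ℕ) = 0 ∧ (i : ℕ) = 1)) with h | h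
      · exact bAct_braid4 X i j h.1 h.2
      · exact (bAct_braid4 X j i h.1 h.2).symm
    rw [H X]; simp only [bAct_bAct]
  · show bAct n (bAct n (bAct n (bAct n (bAct n (bAct n X i) j) i) j) i) j = X
    have H : ∀ X, bAct n (bAct n (bAct n X i) j) i = bAct n (bAct n (bAct n X j) i) j := by
      intro X
      rcases h3 with h | h
      · exact (bAct_braid3 X j i (by omega) h).symm
      · exact bAct_braid3 X i j (by omega) h
    rw [H X]; simp only [bAct_bAct]
  · show bAct n (bAct n (bAct n (bAct n X i) j) i) j = X
    have H : ∀ X, bAct n (bAct n X i) j = bAct n (bAct n X j) i := by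
      intro X
      have : (i : ℕ) ≠ j := fun h ↦ h1 (Fin.ext h)
      rcases (by omega : (i : ℕ) + 1 < j ∨ (j : ℕ) + 1 < i) with h | h
      · exact bAct_comm X i j h
      · exact (bAct_comm X j i h).symm
    rw [H X]; simp only [bAct_bAct]

theorem foldl_eq {n : ℕ} {W : Type*} [Group W] (cs : CoxeterSystem (BCox n) W)
    (w : List (Fin n)) (X : Finset ℕ) :
    w.foldl (bAct n) X = (cs.lift ⟨act n, act_liftable n⟩ (cs.wordProd w)).unop X := by
  induction w generalizing X with
  | nil => simp; rfl
  | cons i w ih =>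
    rw [List.foldl_cons, ih, cs.wordProd_cons, map_mul, cs.lift_apply_simple]
    rfl

theorem foldl_congr {n : ℕ} {W : Type*} [Group W] (cs : CoxeterSystem (BCox n) W)
    {w w' : List (Fin n)} (h : cs.wordProd w = cs.wordProd w') (X : Finset ℕ) :
    w.foldl (bAct n) X = w'.foldl (bAct n) X := by
  rw [foldl_eq cs, foldl_eq cs, h]

/-- `s i` is an ascent of `X`. -/
def Up {n : ℕ} (X : Finset ℕ) (i : Fin n) : Prop :=
  (i : ℕ) + 1 ∉ X ∧ ((i : ℕ) = 0 ∨ (i : ℕ) ∈ X)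

/-- `s i` is a descent of `X`. -/
def Dn {n : ℕ} (X : Finset ℕ) (i : Fin n) : Prop :=
  (i : ℕ) + 1 ∈ X ∧ ((i : ℕ) = 0 ∨ (i : ℕ) ∉ X)

theorem up_of_dn {n : ℕ} {X : Finset ℕ} {i : Fin n} (h : Dn X i) : Up (bAct n X i) i := by
  unfold Dn at h; unfold Up; simp only [mem_bAct]; grind

theorem dn_of_up {n : ℕ} {X : Finset ℕ} {i : Fin n} (h : Up X i) : Dn (bAct n X i) i := by
  unfold Up at h; unfold Dn; simp only [mem_bAct]; grind

/-- number of elements of `X` that are at least `m` -/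
def c (X : Finset ℕ) (m : ℕ) : ℕ := (X.filter (m ≤ ·)).card

theorem c_succ (X : Finset ℕ) (m : ℕ) : c X m = c X (m + 1) + if m ∈ X then 1 else 0 := by
  unfold c
  split_ifs with h
  · have : X.filter (m ≤ ·) = insert m (X.filter (m + 1 ≤ ·)) := by ext; grind
    rw [this, Finset.card_insert_of_notMem (by simp)]
  · congr 1; ext; grind

theorem c_bAct {n : ℕ} (X : Finset ℕ) (i : Fin n) (m : ℕ) (hm : m ≠ i + 1) (hm0 : m ≠ 0) :
    c (bAct n X i) m = c X m := by
  by_cases h : (i : ℕ) + 1 < m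
  · unfold c; congr 1; ext j; simp only [Finset.mem_filter, mem_bAct]; grind
  · have key : ∀ d : ℕ, d < i → c (bAct n X i) (i - d) = c X (i - d) := by
      intro d hd
      induction d with
      | zero =>
        have e : c (bAct n X i) (i + 2) = c X (i + 2) := by
          unfold c; congr 1; ext j; simp only [Finset.mem_filter, mem_bAct]; grind
        simp only [Nat.sub_zero]
        rw [c_succ _ (i : ℕ), c_succ _ ((i : ℕ) + 1), c_succ X (i : ℕ), c_succ X ((i : ℕ) + 1), e]
        simp only [mem_bAct]; grind
      | succ d ih =>
        have e1 : (i : ℕ) - (d + 1) + 1 = i - d := by omega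
        rw [c_succ, c_succ X, e1, ih (by omega)]
        congr 1
        have : (i : ℕ) - (d + 1) ∈ bAct n X i ↔ (i : ℕ) - (d + 1) ∈ X := by
          rw [mem_bAct]; grind
        simp only [this]
    have := key (i - m) (by omega)
    rwa [show (i : ℕ) - (i - m) = m by omega] at this

theorem c_bAct_self {n : ℕ} (X : Finset ℕ) (i : Fin n) :
    c (bAct n X i) (i + 1) + (if (i : ℕ) + 1 ∈ X then 1 else 0)
      = c X (i + 1) + if (i : ℕ) + 1 ∈ bAct n X i then 1 else 0 := by
  rw [c_succ, c_succ X, c_bAct X i _ (by omega) (by omega)]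
  omega

theorem c_up {n : ℕ} {X : Finset ℕ} {i : Fin n} (h : Up X i) :
    c (bAct n X i) (i + 1) = c X (i + 1) + 1 := by
  have h1 := c_bAct_self X i
  have h2 := (dn_of_up h).1
  rw [if_pos h2, if_neg h.1] at h1
  omega

/-- containment order -/
def Le (Y X : Finset ℕ) : Prop := ∀ m, m ≠ 0 → c Y m ≤ c X m

theorem le_up {n : ℕ} {A X : Finset ℕ} {i : Fin n} (h : Up X i) (hA : Le A X) :
    Le A (bAct n X i) := by
  intro m hm
  have := hA m hm
  by_cases h' : m = i + 1
  · subst h'; rw [c_up h]; omega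
  · rw [c_bAct X i m h' hm]; exact this

theorem le_up' {n : ℕ} {A X : Finset ℕ} {i : Fin n} (h : Up X i) (hA : Le A X) :
    Le (bAct n A i) (bAct n X i) := by
  intro m hm
  have := hA m hm
  by_cases h' : m = i + 1
  · subst h'; rw [c_up h]; have := c_bAct_self A i; grind
  · rw [c_bAct X i m h' hm, c_bAct A i m h' hm]; exact this

theorem le_dn {n : ℕ} {Y X : Finset ℕ} {i : Fin n} (h : Up X i) (hY : Dn Y i)
    (hA : Le Y (bAct n X i)) : Le (bAct n Y i) X := by
  intro m hm
  have := hA m hm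
  have h2 := c_up (up_of_dn hY)
  rw [bAct_bAct] at h2
  by_cases h' : m = i + 1
  · subst h'; rw [c_up h] at this; omega
  · rw [c_bAct X i m h' hm] at this; rwa [c_bAct Y i m h' hm]

theorem le_dn' {n : ℕ} {Y X : Finset ℕ} {i : Fin n} (h : Up X i) (hY : ¬ Dn Y i)
    (hA : Le Y (bAct n X i)) : Le Y X := by
  intro m hm
  have h0 := hA m hm
  by_cases h' : m = i + 1
  · subst h'
    by_contra hc
    rw [c_up h] at h0
    have h2 := hA (i + 1 + 1) (by omega)
    rw [c_bAct X i _ (by omega) (by omega)] at h2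
    have h3 := c_succ Y (i + 1)
    have h4 := c_succ X (i + 1)
    rw [if_neg h.1] at h4
    have h5 : (i : ℕ) + 1 ∈ Y := by by_contra h6; rw [if_neg h6] at h3; omega
    have h6 : (i : ℕ) ≠ 0 ∧ (i : ℕ) ∈ Y := by unfold Dn at hY; tauto
    have h7 := hA i h6.1
    rw [c_bAct X i _ (by omega) h6.1] at h7
    have h8 := c_succ Y i
    have h9 := c_succ X i
    have h10 : (i : ℕ) ∈ X := by unfold Up at h; tauto
    rw [if_pos h6.2] at h8
    rw [if_pos h10] at h9
    omega
  · rwa [c_bAct X i m h' hm] at h0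

/-- paths from the empty set all of whose steps are ascents -/
inductive Good (n : ℕ) : Finset ℕ → List (Fin n) → Prop
  | nil : Good n ∅ []
  | step (X : Finset ℕ) (w : List (Fin n)) (i : Fin n) (hg : Good n X w) (hu : Up X i) :
      Good n (bAct n X i) (w ++ [i])

theorem sum_up {n : ℕ} {X : Finset ℕ} {i : Fin n} (h : Up X i) :
    ∑ t ∈ bAct n X i, t = ∑ t ∈ X, t + 1 := by
  obtain ⟨h1, h2⟩ := h
  unfold bAct
  by_cases h0 : (i : ℕ) = 0
  · rw [h0] at h1
    rw [if_pos h0, if_neg h1, Finset.sum_insert h1]; omega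
  · have h3 : (i : ℕ) ∈ X := by tauto
    rw [if_neg h0, if_pos ⟨h3, h1⟩, Finset.sum_insert (by simp [h1])]
    have := Finset.add_sum_erase X (fun t ↦ t) h3
    omega

theorem sum_dn {n : ℕ} {X : Finset ℕ} {i : Fin n} (h : Dn X i) :
    ∑ t ∈ bAct n X i, t + 1 = ∑ t ∈ X, t := by
  have := sum_up (up_of_dn h)
  rw [bAct_bAct] at this; exact this.symm

theorem good_len {n : ℕ} {X : Finset ℕ} {w : List (Fin n)} (h : Good n X w) :
    w.length = ∑ t ∈ X, t := by
  induction h with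
  | nil => simp
  | step X w i hg hu ih => rw [sum_up hu, List.length_append, ih]; rfl

theorem sub_bAct {n : ℕ} {X : Finset ℕ} {i : Fin n} (hX : X ⊆ Finset.Icc 1 n) :
    bAct n X i ⊆ Finset.Icc 1 n := by
  intro j hj
  have hi := i.2
  rw [mem_bAct] at hj
  have := @hX j
  rw [Finset.mem_Icc] at *
  grind

theorem good_sub {n : ℕ} {X : Finset ℕ} {w : List (Fin n)} (h : Good n X w) :
    X ⊆ Finset.Icc 1 n := by
  induction h with
  | nil => simp
  | step X w i hg hu ih => exact sub_bAct ih

theorem good_foldl {n : ℕ} {X : Finset ℕ} {w : List (Fin n)} (h : Good n X w) :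
    w.foldl (bAct n) ∅ = X := by
  induction h with
  | nil => simp
  | step X w i hg hu ih => simp [ih]

theorem exists_dn {n : ℕ} {X : Finset ℕ} (hX : X ⊆ Finset.Icc 1 n) (hne : X.Nonempty) :
    ∃ i : Fin n, Dn X i := by
  have h1 := X.min'_mem hne
  have h2 := Finset.mem_Icc.1 (hX h1)
  refine ⟨⟨X.min' hne - 1, by omega⟩, ?_, ?_⟩
  · simpa [Nat.sub_add_cancel h2.1] using h1
  · right
    intro h
    have := X.min'_le _ h
    simp only at this
    omega

theorem exists_good {n : ℕ} (k : ℕ) : ∀ X : Finset ℕ, X ⊆ Finset.Icc 1 n → ∑ t ∈ X, t = k →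
    ∃ w, Good n X w := by
  induction k with
  | zero =>
    intro X hX hk
    rcases X.eq_empty_or_nonempty with rfl | hne
    · exact ⟨_, .nil⟩
    · obtain ⟨i, hi⟩ := exists_dn hX hne
      have := sum_dn hi
      omega
  | succ k ih =>
    intro X hX hk
    rcases X.eq_empty_or_nonempty with rfl | hne
    · exact ⟨_, .nil⟩
    · obtain ⟨i, hi⟩ := exists_dn hX hne
      have := sum_dn hi
      obtain ⟨w, hw⟩ := ih (bAct n X i) (sub_bAct hX) (by omega)
      have := Good.step _ _ _ hw (up_of_dn hi)
      rw [bAct_bAct] at this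
      exact ⟨_, this⟩

section
variable {n : ℕ} {W : Type*} [Group W] (cs : CoxeterSystem (BCox n) W)

theorem rel_comm (i j : Fin n) (h : (i : ℕ) + 1 < j) :
    cs.simple i * cs.simple j = cs.simple j * cs.simple i := by
  have h1 := cs.simple_mul_simple_pow i j
  rw [M_eq, if_neg (by intro h; subst h; omega), if_neg (by omega), if_neg (by omega)] at h1
  rw [mul_eq_one_iff_eq_inv.1 ((pow_two _).symm.trans h1)]
  simp

theorem rel_comm' (i j : Fin n) (h : (i : ℕ) + 1 < j ∨ (j : ℕ) + 1 < i) :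
    cs.simple i * cs.simple j = cs.simple j * cs.simple i := by
  rcases h with h | h
  · exact rel_comm cs i j h
  · exact (rel_comm cs j i h).symm

theorem rel_braid3 (i j : Fin n) (h0 : (i : ℕ) ≠ 0) (h : (i : ℕ) + 1 = j) :
    cs.simple i * cs.simple j * cs.simple i = cs.simple j * cs.simple i * cs.simple j := by
  have h1 := cs.simple_mul_simple_pow i j
  rw [M_eq, if_neg (by intro h; subst h; omega), if_neg (by omega), if_pos (by omega)] at h1
  have h2 : (cs.simple i * cs.simple j * cs.simple i) * (cs.simple j * cs.simple i * cs.simple j) = 1 := by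
    rw [← h1]; simp only [pow_succ, pow_zero, one_mul, mul_assoc]
  rw [mul_eq_one_iff_eq_inv.1 h2]
  simp [mul_assoc]

theorem rel_braid4 (i j : Fin n) (h0 : (i : ℕ) = 0) (h : (j : ℕ) = 1) :
    cs.simple i * cs.simple j * cs.simple i * cs.simple j
      = cs.simple j * cs.simple i * cs.simple j * cs.simple i := by
  have h1 := cs.simple_mul_simple_pow i j
  rw [M_eq, if_neg (by intro h; subst h; omega), if_pos (by omega)] at h1
  have h2 : (cs.simple i * cs.simple j * cs.simple i * cs.simple j) *
      (cs.simple i * cs.simple j * cs.simple i * cs.simple j) = 1 := by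
    rw [← h1]; simp only [pow_succ, pow_zero, one_mul, mul_assoc]
  rw [mul_eq_one_iff_eq_inv.1 h2]
  simp [mul_assoc]

theorem good_unique (k : ℕ) : ∀ (X : Finset ℕ) (w w' : List (Fin n)), ∑ t ∈ X, t = k →
    Good n X w → Good n X w' → cs.wordProd w = cs.wordProd w' := by
  induction k using Nat.strong_induction_on with
  | _ k ih =>
  intro X w w' hk hw hw'
  have hl := good_len hw
  have hl' := good_len hw'
  rcases hw with _ | ⟨X1, w1, i, hg, hu⟩
  · have : w' = [] := by apply List.eq_nil_of_length_eq_zero; simpa using hl'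
    rw [this]
  · generalize hZ : bAct n X1 i = Z at *
    rcases hw' with _ | ⟨X2, w2, j, hg', hu'⟩
    · simp at hl
    · have hX1 := good_sub hg
      have hX2 := good_sub hg'
      have s1 := sum_up hu
      have s2 := sum_up hu'
      have d1 := dn_of_up hu
      have d2 := dn_of_up hu'
      have e1 : X1 = bAct n (bAct n X2 j) i := by rw [← hZ, bAct_bAct]
      rw [hZ] at d1 s1
      by_cases hij : i = j
      · subst hij
        rw [bAct_bAct] at e1
        subst e1
        rw [cs.wordProd_append, cs.wordProd_append, ih _ (by omega) _ w1 w2 rfl hg hg']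
      · have hij' : (i : ℕ) ≠ j := fun h ↦ hij (Fin.ext h)
        have far : (i : ℕ) + 1 < j ∨ (j : ℕ) + 1 < i := by
          unfold Dn at d1 d2
          grind
        have dd : Dn X1 j := by
          rw [e1]; unfold Dn at *; simp only [mem_bAct] at *; grind
        have e2 : bAct n X1 j = bAct n X2 i := by
          rw [e1]
          rcases far with h | h
          · rw [bAct_comm _ i j h, bAct_bAct]
          · rw [← bAct_comm _ j i h, bAct_bAct]
        have s3 := sum_dn dd
        obtain ⟨v, hv⟩ := exists_good _ (bAct n X1 j) (sub_bAct hX1) rfl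
        have g1 := Good.step _ _ _ hv (up_of_dn dd)
        rw [bAct_bAct] at g1
        have dd2 : Dn X2 i := by
          have : X2 = bAct n (bAct n X1 i) j := by rw [hZ, bAct_bAct]
          unfold Dn at *; simp only [mem_bAct] at *; grind
        have g2 := Good.step _ _ i hv (by rw [e2]; exact up_of_dn dd2)
        rw [e2, bAct_bAct] at g2
        have t1 := ih _ (by omega) _ _ _ rfl hg g1
        have t2 := ih _ (by omega) _ _ _ rfl hg' g2
        simp only [cs.wordProd_append, cs.wordProd_singleton] at *
        rw [t1, t2, mul_assoc, mul_assoc, rel_comm' cs i j far]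

/-- `x` is the element attached to `X` -/
def GE (X : Finset ℕ) (x : W) : Prop := ∃ w, Good n X w ∧ cs.wordProd w = x

theorem ge_up {X : Finset ℕ} {x : W} {i : Fin n} (h : GE cs X x) (hu : Up X i) :
    GE cs (bAct n X i) (x * cs.simple i) := by
  obtain ⟨w, hw, rfl⟩ := h
  exact ⟨_, Good.step _ _ _ hw hu, by simp [cs.wordProd_append]⟩

theorem ge_unique {X : Finset ℕ} {x y : W} (h : GE cs X x) (h' : GE cs X y) : x = y := by
  obtain ⟨w, hw, rfl⟩ := h
  obtain ⟨w', hw', rfl⟩ := h'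
  exact good_unique cs _ X w w' rfl hw hw'

theorem ge_sub {X : Finset ℕ} {x : W} (h : GE cs X x) : X ⊆ Finset.Icc 1 n := by
  obtain ⟨w, hw, rfl⟩ := h
  exact good_sub hw

theorem ge_exists {X : Finset ℕ} (h : X ⊆ Finset.Icc 1 n) : ∃ x, GE cs X x := by
  obtain ⟨v, hv⟩ := exists_good _ X h rfl
  exact ⟨_, v, hv, rfl⟩

theorem ge_dn {X : Finset ℕ} {x : W} {i : Fin n} (h : GE cs X x) (hd : Dn X i) :
    GE cs (bAct n X i) (x * cs.simple i) := by
  obtain ⟨z, hz⟩ := ge_exists cs (sub_bAct (i := i) (ge_sub cs h))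
  have h1 := ge_up cs hz (up_of_dn hd)
  rw [bAct_bAct] at h1
  rw [ge_unique cs h h1]
  simpa using hz

theorem ge_len {X : Finset ℕ} {x : W} (h : GE cs X x) : cs.length x ≤ ∑ t ∈ X, t := by
  obtain ⟨w, hw, rfl⟩ := h
  rw [← good_len hw]
  exact cs.length_wordProd_le w

theorem ge_fix (k : ℕ) : ∀ (X : Finset ℕ) (x : W) (i : Fin n), ∑ t ∈ X, t = k → GE cs X x →
    (i : ℕ) ≠ 0 → ((i : ℕ) ∈ X ↔ (i : ℕ) + 1 ∈ X) →
    ∃ j : Fin n, (j : ℕ) ≠ 0 ∧ x * cs.simple i = cs.simple j * x := by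
  induction k using Nat.strong_induction_on with
  | _ k ih =>
  intro X x i hk hx hi hfix
  rcases X.eq_empty_or_nonempty with rfl | hne
  · refine ⟨i, hi, ?_⟩
    have : x = 1 := ge_unique cs hx ⟨[], .nil, by simp⟩
    simp [this]
  obtain ⟨d, hd⟩ := exists_dn (ge_sub cs hx) hne
  have g1 := ge_dn cs hx hd
  have s1 := sum_dn hd
  have hdi : (d : ℕ) ≠ i := by unfold Dn at hd; grind
  by_cases far : (i : ℕ) + 1 < d ∨ (d : ℕ) + 1 < i
  · obtain ⟨j, hj, e⟩ := ih _ (by omega) _ _ i rfl g1 hi (by simp only [mem_bAct]; grind)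
    refine ⟨j, hj, ?_⟩
    rw [mul_assoc, ← rel_comm' cs i d far, ← mul_assoc, ← mul_assoc] at e
    exact mul_right_cancel e
  have d2 : Dn (bAct n X d) i := by
    unfold Dn at *; simp only [mem_bAct]; grind
  have g2 := ge_dn cs g1 d2
  have s2 := sum_dn d2
  by_cases h4 : (d : ℕ) = 0
  · have hi1 : (i : ℕ) = 1 := by omega
    have d3 : Dn (bAct n (bAct n X d) i) d := by
      unfold Dn at *; simp only [mem_bAct]; grind
    have g3 := ge_dn cs g2 d3
    have s3 := sum_dn d3
    obtain ⟨j, hj, e⟩ := ih _ (by omega) _ _ i rfl g3 hi (by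
      unfold Dn at *; simp only [mem_bAct]; grind)
    refine ⟨j, hj, ?_⟩
    have b := rel_braid4 cs d i h4 hi1
    have : x * (cs.simple d * cs.simple i * cs.simple d * cs.simple i)
        = cs.simple j * x * (cs.simple d * cs.simple i * cs.simple d) := by
      simpa only [mul_assoc] using e
    rw [b] at this
    have t := congrArg (· * (cs.simple d * cs.simple i * cs.simple d)) this
    simpa [mul_assoc] using t
  · obtain ⟨j, hj, e⟩ := ih _ (by omega) _ _ d rfl g2 h4 (by
      unfold Dn at *; simp only [mem_bAct]; grind)
    refine ⟨j, hj, ?_⟩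
    have b : cs.simple d * cs.simple i * cs.simple d = cs.simple i * cs.simple d * cs.simple i := by
      rcases (by omega : (d : ℕ) + 1 = i ∨ (i : ℕ) + 1 = d) with h | h
      · exact rel_braid3 cs d i h4 h
      · exact (rel_braid3 cs i d hi h).symm
    have : x * (cs.simple d * cs.simple i * cs.simple d)
        = cs.simple j * x * (cs.simple d * cs.simple i) := by
      simpa only [mul_assoc] using e
    rw [b] at this
    have t := congrArg (· * (cs.simple i * cs.simple d)) this
    simpa [mul_assoc] using t

theorem reduced_good (w : List (Fin n)) : cs.IsReduced w → cs.wordProd w ∈ IWset cs →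
    Good n (w.foldl (bAct n) ∅) w := by
  induction w using List.reverseRecOn with
  | nil => intro _ _; exact .nil
  | append_singleton w i ih =>
    intro hr hI
    have hr' : cs.IsReduced w := by simpa using hr.take w.length
    have hl := hr.eq
    have hl' := hr'.eq
    rw [List.length_append, cs.wordProd_append, cs.wordProd_singleton, List.length_singleton] at hl
    rw [cs.wordProd_append, cs.wordProd_singleton] at hI
    have hI' : cs.wordProd w ∈ IWset cs := by
      intro j hj
      have h1 := hI j hj
      have h2 := cs.length_mul_le (cs.simple j * cs.wordProd w) (cs.simple i)
      rw [cs.length_simple, mul_assoc] at h2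
      omega
    have g := ih hr' hI'
    rw [List.foldl_append, List.foldl_cons, List.foldl_nil]
    have gl := good_len g
    generalize w.foldl (bAct n) ∅ = X at *
    have ge : GE cs X (cs.wordProd w) := ⟨w, g, rfl⟩
    by_cases hu : Up X i
    · exact Good.step _ _ _ g hu
    exfalso
    by_cases hd : Dn X i
    · have := ge_len cs (ge_dn cs ge hd)
      have := sum_dn hd
      omega
    · obtain ⟨j, hj, e⟩ := ge_fix cs _ X _ i rfl ge (by unfold Up Dn at *; tauto)
        (by unfold Up Dn at *; tauto)
      have h1 := hI j hj
      rw [e, cs.simple_mul_simple_cancel_left, ← e] at h1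
      omega

theorem good_sublist_le {X : Finset ℕ} {w : List (Fin n)} (h : Good n X w) :
    ∀ w' : List (Fin n), w' <+ w → Le (w'.foldl (bAct n) ∅) X := by
  induction h with
  | nil => intro w' h; rw [List.sublist_nil.1 h]; intro m _; exact le_rfl
  | step X w i hg hu ih =>
    intro w' h
    obtain ⟨a, b, rfl, ha, hb⟩ := List.sublist_append_iff.1 h
    rcases List.sublist_singleton.1 hb with rfl | rfl
    · simpa using le_up hu (ih a ha)
    · simpa using le_up' hu (ih a ha)

theorem good_le_sublist {X : Finset ℕ} {w : List (Fin n)} (h : Good n X w) :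
    ∀ (Y : Finset ℕ) (y : W), GE cs Y y → Le Y X → ∃ w', w' <+ w ∧ cs.wordProd w' = y := by
  induction h with
  | nil =>
    intro Y y hy hle
    have : Y = ∅ := by
      rw [Finset.eq_empty_iff_forall_notMem]
      intro t ht
      have h1 := Finset.mem_Icc.1 (ge_sub cs hy ht)
      have h2 := hle t (by omega)
      rw [c_succ Y, if_pos ht] at h2
      simp [c] at h2
    subst this
    exact ⟨[], List.Sublist.refl _, ge_unique cs ⟨[], .nil, rfl⟩ hy⟩
  | step X w i hg hu ih =>
    intro Y y hy hle
    by_cases hd : Dn Y i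
    · obtain ⟨w', hs, e⟩ := ih _ _ (ge_dn cs hy hd) (le_dn hu hd hle)
      exact ⟨w' ++ [i], hs.append (List.Sublist.refl _), by simp [cs.wordProd_append, e]⟩
    · obtain ⟨w', hs, e⟩ := ih _ _ hy (le_dn' hu hd hle)
      exact ⟨w', hs.trans (List.sublist_append_left _ _), e⟩

end

theorem c_list (T : List ℕ) (hT : T.Pairwise (· > ·)) (m : ℕ) (hm : m ≠ 0) (j : ℕ) :
    j < c T.toFinset m ↔ m ≤ T.getD j 0 := by
  have hc : c T.toFinset m = (T.filter (m ≤ ·)).length := by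
    unfold c
    have hn : T.Nodup := hT.imp (fun h ↦ Nat.ne_of_gt h)
    rw [show T.toFinset.filter (m ≤ ·) = (T.filter (m ≤ ·)).toFinset by ext; simp, List.toFinset_card_of_nodup (hn.filter _)]
  rw [hc]
  clear hc
  induction T generalizing j with
  | nil => simp; omega
  | cons a T ih =>
    rw [List.pairwise_cons] at hT
    by_cases ha : m ≤ a
    · rw [List.filter_cons_of_pos (by simpa using ha)]
      cases j with
      | zero => simp [ha]
      | succ j => simpa using ih hT.2 j
    · have : T.filter (m ≤ ·) = [] := by
        rw [List.filter_eq_nil_iff]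
        intro t ht
        have := hT.1 t ht
        simp; omega
      rw [List.filter_cons_of_neg (by simpa using ha), this]
      simp only [List.length_nil, not_lt_zero, false_iff]
      cases j with
      | zero => simpa using ha
      | succ j =>
        have h := ih hT.2 j
        rw [this] at h
        simpa using h

theorem le_iff (T U : List ℕ) (hT : T.Pairwise (· > ·)) (hU : U.Pairwise (· > ·))
    (hmemT : ∀ t ∈ T, t ≠ 0) (hmemU : ∀ t ∈ U, t ≠ 0) :
    Le U.toFinset T.toFinset ↔
      U.length ≤ T.length ∧ ∀ j < U.length, U.getD j 0 ≤ T.getD j 0 := by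
  constructor
  · intro h
    have key : ∀ j < U.length, U.getD j 0 ≤ T.getD j 0 ∧ U.getD j 0 ≠ 0 := by
      intro j hj
      have h0 : U.getD j 0 ≠ 0 := by
        rw [List.getD_eq_getElem _ _ hj]; exact hmemU _ (List.getElem_mem hj)
      exact ⟨(c_list T hT _ h0 j).1 (lt_of_lt_of_le ((c_list U hU _ h0 j).2 le_rfl) (h _ h0)), h0⟩
    refine ⟨?_, fun j hj ↦ (key j hj).1⟩
    by_contra hc
    have := key T.length (by omega)
    rw [List.getD_eq_default T _ le_rfl] at this
    omega
  · rintro ⟨h1, h2⟩ m hm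
    by_contra hc
    have h3 := (c_list U hU m hm (c T.toFinset m)).1 (by omega)
    have h4 : c T.toFinset m < U.length := by
      by_contra h
      rw [List.getD_eq_default U _ (by omega)] at h3
      omega
    have h5 := (c_list T hT m hm (c T.toFinset m)).2 (h3.trans (h2 _ h4))
    omega

end B9

/-- Let `x, y ∈ ᴵW` correspond to `X = {t₁ > … > t_k}` and
`Y = {u₁ > … > u_l}`. Then `y ≤ x` in the Bruhat order on `W` if and only if `l ≤ k` and
`u_j ≤ t_j` for every `1 ≤ j ≤ l`: under the bijection `ᴵW ≅ 𝒫([n])`, the Bruhat order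
corresponds to the containment order on strict partitions with largest part at most `n`. -/
theorem stmt_9 (n : ℕ) (hn : 2 ≤ n) {W : Type*} [Group W] (cs : CoxeterSystem (BCox n) W)
    (T U : List ℕ) (hT : T.Chain' (· > ·)) (hU : U.Chain' (· > ·))
    (hmemT : ∀ t ∈ T, t ∈ Finset.Icc 1 n) (hmemU : ∀ t ∈ U, t ∈ Finset.Icc 1 n)
    (x y : W) (hx : x ∈ IWset cs) (hy : y ∈ IWset cs)
    (hcx : corr cs x T.toFinset) (hcy : corr cs y U.toFinset) :
    BruhatLE cs y x ↔ U.length ≤ T.length ∧ ∀ j < U.length, U.getD j 0 ≤ T.getD j 0 := by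
  have pT : T.Pairwise (· > ·) := List.isChain_iff_pairwise.1 hT
  have pU : U.Pairwise (· > ·) := List.isChain_iff_pairwise.1 hU
  rw [← B9.le_iff T U pT pU
    (fun t ht ↦ by have := Finset.mem_Icc.1 (hmemT t ht); omega)
    (fun t ht ↦ by have := Finset.mem_Icc.1 (hmemU t ht); omega)]
  obtain ⟨wx, hwx, ex⟩ := hcx
  obtain ⟨wy, hwy, ey⟩ := hcy
  constructor
  · rintro ⟨w, hr, hw, w', hs, hw'⟩
    have g := B9.reduced_good cs w hr (hw ▸ hx)
    have h := B9.good_sublist_le g w' hs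
    rwa [B9.foldl_congr cs (hw.trans hwx.symm), B9.foldl_congr cs (hw'.trans hwy.symm), ex, ey] at h
  · intro hle
    obtain ⟨w, hr, hw⟩ := cs.exists_isReduced x
    obtain ⟨v, hrv, hv⟩ := cs.exists_isReduced y
    have g := B9.reduced_good cs w hr (hw ▸ hx)
    have gy := B9.reduced_good cs v hrv (hv ▸ hy)
    rw [B9.foldl_congr cs (hw.symm.trans hwx.symm), ex] at g
    rw [B9.foldl_congr cs (hv.symm.trans hwy.symm), ey] at gy
    exact ⟨w, hr, hw.symm, B9.good_le_sublist cs g _ y ⟨v, gy, hv.symm⟩ hle⟩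
end

section
/- Let x ∈ ᴵW, let u be any reduced word for x, and let y ∈ W. Then there is at most one I-parabolic subexpression of u whose product equals y. -/
open List

/-- Auxiliary: the product of a subexpression, with prefix products starting at `x`. -/
def subProdAux {n : ℕ} {W : Type*} [Group W] (cs : CoxeterSystem (BCox n) W) :
    W → List (Fin n × Bool) → W
  | x, [] => x
  | x, (i, b) :: rest => subProdAux cs (if b then x * cs.simple i else x) rest

/-- The product `x_m` of the subexpression `e` of the word `u`. -/
def subProd {n : ℕ} {W : Type*} [Group W] (cs : CoxeterSystem (BCox n) W)
    (u : List (Fin n)) (e : List Bool) : W :=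
  subProdAux cs 1 (u.zip e)

/-- Auxiliary: the subexpression (with prefix products starting at `x`) is parabolic with
respect to the set `P`. -/
def IsParAux {n : ℕ} {W : Type*} [Group W] (cs : CoxeterSystem (BCox n) W) (P : Set W) :
    W → List (Fin n × Bool) → Prop
  | _, [] => True
  | x, (i, b) :: rest =>
      x * cs.simple i ∈ P ∧ IsParAux cs P (if b then x * cs.simple i else x) rest

/-- The subexpression `e` of the word `u` is parabolic with respect to the set `P` of minimal
coset representatives: `x_{p−1} σ_p ∈ P` for every position `p`. -/
def IsPara {n : ℕ} {W : Type*} [Group W] (cs : CoxeterSystem (BCox n) W) (P : Set W)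
    (u : List (Fin n)) (e : List Bool) : Prop :=
  IsParAux cs P 1 (u.zip e)

section abstractpart
variable {W : Type*} [Group W]

def cEl (s : ℕ → W) : ℕ → W
  | 0 => s 0
  | j + 1 => cEl s j * s (j + 1)

def XEl (s : ℕ → W) (v : ℕ → ZMod 2) : ℕ → W
  | 0 => 1
  | m + 1 => (if v m = 1 then cEl s m else 1) * XEl s v m

structure BRel (n : ℕ) (s : ℕ → W) : Prop where
  sq : ∀ k, k < n → s k * s k = 1
  comm : ∀ j k, j + 2 ≤ k → k < n → s j * s k = s k * s j
  br : ∀ k, 1 ≤ k → k + 1 < n → s k * s (k+1) * s k = s (k+1) * s k * s (k+1)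
  four : 1 < n → s 0 * s 1 * s 0 * s 1 = s 1 * s 0 * s 1 * s 0

variable {n : ℕ} {s : ℕ → W}

lemma cEl_comm (h : BRel n s) (j k : ℕ) (hjk : j + 2 ≤ k) (hk : k < n) :
    cEl s j * s k = s k * cEl s j := by
  induction j with
  | zero => exact h.comm 0 k hjk hk
  | succ j ih =>
    simp only [cEl]
    rw [mul_assoc, h.comm (j+1) k hjk hk, ← mul_assoc, ih (by omega), mul_assoc]

lemma XEl_comm (h : BRel n s) (v : ℕ → ZMod 2) (m k : ℕ) (hjk : m + 1 ≤ k) (hk : k < n) :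
    XEl s v m * s k = s k * XEl s v m := by
  induction m with
  | zero => simp [XEl]
  | succ m ih =>
    simp only [XEl]
    rw [mul_assoc, ih (by omega), ← mul_assoc, ← mul_assoc]
    congr 1
    split_ifs
    · exact cEl_comm h m k (by omega) hk
    · simp

lemma cEl_shift (h : BRel n s) (j k : ℕ) (h1 : 1 ≤ k) (hkj : k < j) (hj : j < n) :
    cEl s j * s k = s (k+1) * cEl s j := by
  induction j with
  | zero => omega
  | succ j ih =>
    rcases Nat.lt_or_ge k j with hk | hk
    · simp only [cEl]
      rw [mul_assoc, ← h.comm k (j+1) (by omega) hj, ← mul_assoc, ih hk (by omega), mul_assoc]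
    · obtain rfl : k = j := by omega
      obtain ⟨i, rfl⟩ : ∃ i, k = i + 1 := ⟨k - 1, by omega⟩
      simp only [cEl]
      calc cEl s i * s (i+1) * s (i+1+1) * s (i+1)
          = cEl s i * (s (i+1) * s (i+1+1) * s (i+1)) := by simp only [mul_assoc]
        _ = (cEl s i * s (i+1+1)) * s (i+1) * s (i+1+1) := by
            rw [h.br (i+1) h1 hj]; simp only [mul_assoc]
        _ = _ := by rw [cEl_comm h i (i+1+1) (by omega) hj]; simp only [mul_assoc]

lemma cEl_sq (h : BRel n s) (i : ℕ) (hi : i + 1 < n) :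
    cEl s (i+1) * cEl s (i+1) = s 1 * cEl s (i+1) * cEl s i := by
  induction i with
  | zero =>
    simp only [cEl]
    have := h.four (by omega)
    simp only [mul_assoc] at this ⊢
    simpa using this
  | succ i ih =>
    have h1 : cEl s (i+1+1) = cEl s (i+1) * s (i+1+1) := rfl
    have h0 : cEl s (i+1) = cEl s i * s (i+1) := rfl
    have hc := cEl_comm h i (i+1+1) (by omega) hi
    have hb := h.br (i+1) (by omega) hi
    calc cEl s (i+1+1) * cEl s (i+1+1)
        = cEl s (i+1) * s (i+1+1) * (cEl s i * s (i+1) * s (i+1+1)) := by rw [h1, h0]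
      _ = cEl s (i+1) * (s (i+1+1) * cEl s i) * s (i+1) * s (i+1+1) := by
          simp only [mul_assoc]
      _ = cEl s (i+1) * cEl s i * (s (i+1+1) * s (i+1) * s (i+1+1)) := by
          rw [← hc]; simp only [mul_assoc]
      _ = cEl s (i+1) * (cEl s i * s (i+1)) * s (i+1+1) * s (i+1) := by
          rw [← hb]; simp only [mul_assoc]
      _ = (cEl s (i+1) * cEl s (i+1)) * s (i+1+1) * s (i+1) := by rw [h0]
      _ = s 1 * cEl s (i+1) * (cEl s i * s (i+1+1)) * s (i+1) := by
          rw [ih (by omega)]; simp only [mul_assoc]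
      _ = s 1 * (cEl s (i+1) * s (i+1+1)) * (cEl s i * s (i+1)) := by
          rw [hc]; simp only [mul_assoc]
      _ = _ := by rw [h1, h0]

lemma XEl_congr (v v' : ℕ → ZMod 2) (m : ℕ) (hv : ∀ j, j < m → v j = v' j) :
    XEl s v m = XEl s v' m := by
  induction m with
  | zero => rfl
  | succ m ih => simp only [XEl]; rw [hv m (by omega), ih (fun j hj => hv j (by omega))]

lemma XEl_fixed (h : BRel n s) (v : ℕ → ZMod 2) (m i : ℕ) (him : i + 1 < m) (hm : m ≤ n)
    (hv : v i = v (i+1)) :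
    ∃ j, 1 ≤ j ∧ j < m ∧ XEl s v m * s (i+1) = s j * XEl s v m := by
  induction m with
  | zero => omega
  | succ m ih =>
    rcases Nat.lt_or_ge (i+1) m with hk | hk
    · obtain ⟨j, hj1, hjm, hj⟩ := ih hk (by omega)
      simp only [XEl]
      split_ifs
      · refine ⟨j+1, by omega, by omega, ?_⟩
        rw [mul_assoc, hj, ← mul_assoc, cEl_shift h m j hj1 hjm (by omega), mul_assoc]
      · exact ⟨j, hj1, by omega, by simpa using hj⟩
    · obtain rfl : m = i + 1 := by omega
      simp only [XEl]
      have hx := XEl_comm h v i (i+1) le_rfl (by omega)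
      rw [← hv]
      split_ifs
      · refine ⟨1, le_rfl, by omega, ?_⟩
        have h0 : cEl s (i+1) = cEl s i * s (i+1) := rfl
        calc cEl s (i+1) * (cEl s i * XEl s v i) * s (i+1)
            = cEl s (i+1) * cEl s i * (XEl s v i * s (i+1)) := by simp only [mul_assoc]
          _ = cEl s (i+1) * (cEl s i * s (i+1)) * XEl s v i := by
              rw [hx]; simp only [mul_assoc]
          _ = _ := by rw [← h0, cEl_sq h i (by omega)]; simp only [mul_assoc]
      · exact ⟨i+1, by omega, by omega, by simpa using hx⟩

lemma zmod2_cases (a : ZMod 2) : a = 0 ∨ a = 1 := by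
  revert a; decide

lemma XEl_swap (h : BRel n s) (v v' : ℕ → ZMod 2) (m i : ℕ) (him : i + 1 < m) (hm : m ≤ n)
    (hv : v i ≠ v (i+1)) (h1 : v' i = v (i+1)) (h2 : v' (i+1) = v i)
    (h3 : ∀ j, j ≠ i → j ≠ i + 1 → v' j = v j) :
    XEl s v m * s (i+1) = XEl s v' m := by
  induction m with
  | zero => omega
  | succ m ih =>
    rcases Nat.lt_or_ge (i+1) m with hk | hk
    · simp only [XEl]
      rw [mul_assoc, ih hk (by omega), h3 m (by omega) (by omega)]
    · obtain rfl : m = i + 1 := by omega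
      simp only [XEl]
      have hx := XEl_comm h v i (i+1) le_rfl (by omega)
      have hc : XEl s v' i = XEl s v i :=
        XEl_congr _ _ _ (fun j hj => h3 j (by omega) (by omega))
      have h0 : cEl s (i+1) = cEl s i * s (i+1) := rfl
      rw [h1, h2, hc]
      rcases zmod2_cases (v i) with a | a <;> rcases zmod2_cases (v (i+1)) with b | b
      · simp [a, b] at hv
      · simp only [a, b, h0, zero_ne_one, if_true, if_false, one_mul, mul_assoc, hx]
        rw [← mul_assoc (s (i+1)) (s (i+1)), h.sq _ (by omega), one_mul]
      · simp only [a, b, h0, zero_ne_one, if_true, if_false, one_mul, mul_assoc, hx]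
      · simp [a, b] at hv

lemma XEl_flip (h : BRel n s) (v v' : ℕ → ZMod 2) (m : ℕ) (him : 0 < m) (hm : m ≤ n)
    (h1 : v' 0 = v 0 + 1) (h3 : ∀ j, j ≠ 0 → v' j = v j) :
    XEl s v m * s 0 = XEl s v' m := by
  induction m with
  | zero => omega
  | succ m ih =>
    rcases Nat.eq_zero_or_pos m with rfl | hk
    · simp only [XEl, cEl, h1]
      rcases zmod2_cases (v 0) with a | a
      · simp [a]
      · have : (1 + 1 : ZMod 2) = 0 := by decide
        simp [a, this, h.sq 0 (by omega)]
    · simp only [XEl]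
      rw [mul_assoc, ih hk (by omega), h3 m (by omega)]

/-- weight -/
def NW (v : ℕ → ZMod 2) (m : ℕ) : ℕ := ∑ j ∈ Finset.range m, if v j = 1 then j + 1 else 0

lemma NW_swap (v v' : ℕ → ZMod 2) (m i : ℕ) (him : i + 1 < m)
    (ha : v i = 0) (hb : v (i+1) = 1) (h1 : v' i = 1) (h2 : v' (i+1) = 0)
    (h3 : ∀ j, j ≠ i → j ≠ i + 1 → v' j = v j) :
    NW v' m + 1 = NW v m := by
  induction m with
  | zero => omega
  | succ m ih =>
    rcases Nat.lt_or_ge (i+1) m with hk | hk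
    · have := ih hk
      simp only [NW, Finset.sum_range_succ] at this ⊢
      rw [h3 m (by omega) (by omega)]
      omega
    · obtain rfl : m = i + 1 := by omega
      simp only [NW, Finset.sum_range_succ, ha, hb, h1, h2]
      rw [Finset.sum_congr rfl (fun j hj => by
        rw [h3 j (by have := Finset.mem_range.1 hj; omega) (by have := Finset.mem_range.1 hj; omega)])]
      simp
      omega

lemma NW_flip (v v' : ℕ → ZMod 2) (m : ℕ) (him : 0 < m)
    (ha : v 0 = 1) (h1 : v' 0 = 0) (h3 : ∀ j, j ≠ 0 → v' j = v j) :
    NW v' m + 1 = NW v m := by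
  induction m with
  | zero => omega
  | succ m ih =>
    rcases Nat.eq_zero_or_pos m with rfl | hk
    · simp [NW, ha, h1]
    · have := ih hk
      simp only [NW, Finset.sum_range_succ] at this ⊢
      rw [h3 m (by omega)]
      omega

lemma comb (n m : ℕ) (u : ℕ → ℕ) (D : ℕ → ℕ → ZMod 2) (hu : ∀ p, p < m → u p < n)
    (h0 : ∀ j, D 0 j = 0) (hm : ∀ j, D m j = 0)
    (hs : ∀ p, p < m → ∀ j, j ≠ u p → D (p+1) j = D p j)
    (hc : ∀ p, p < m → ∀ i, u p = i + 1 → D p i = D p (i+2))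
    (hb : ∀ p q i, p < q → q < m → u p = i → u q = i → ∃ r, p < r ∧ r < q ∧ u r = i + 1) :
    ∀ k i, n ≤ i + k → ∀ p, p ≤ m → D p i = 0 := by
  intro k
  induction k with
  | zero =>
    intro i hi p
    induction p with
    | zero => intro _; exact h0 i
    | succ p ih => intro hp; rw [hs p hp i (by have := hu p hp; omega), ih (by omega)]
  | succ k ihk =>
    intro i hi p
    induction p with
    | zero => intro _; exact h0 i
    | succ p ih =>
      intro hp
      by_cases hup : u p = i
      · have hex : ∃ q, p < q ∧ q ≤ m ∧ (q = m ∨ u q = i + 1) := ⟨m, hp, le_rfl, Or.inl rfl⟩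
        classical
        obtain ⟨hq1, hq2, hq3⟩ := Nat.find_spec hex
        have hmin := fun r hr => Nat.find_min hex (m := r) hr
        generalize Nat.find hex = q at *
        have hq0 : D q i = 0 := by
          rcases hq3 with rfl | hq3
          · exact hm i
          · by_cases hqm : q = m
            · rw [hqm]; exact hm i
            · rw [hc q (by omega) i hq3]; exact ihk (i+2) (by omega) q hq2
        have key : ∀ r, p + 1 + r ≤ q → D (p+1+r) i = D (p+1) i := by
          intro r
          induction r with
          | zero => intro _; rfl
          | succ r ihr =>
            intro hr
            rw [← ihr (by omega)]
            refine hs (p+1+r) (by omega) i ?_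
            intro hcon
            obtain ⟨t, ht1, ht2, ht3⟩ := hb p (p+1+r) i (by omega) (by omega) hup hcon.symm
            exact hmin t (by omega) ⟨ht1, by omega, Or.inr ht3⟩
        have := key (q - (p+1)) (by omega)
        rw [show p + 1 + (q - (p+1)) = q by omega] at this
        rw [← this, hq0]
      · rw [hs p hp i (fun h => hup h.symm), ih (by omega)]

end abstractpart
section concretepart
variable {W : Type*} [Group W] {n : ℕ}

def sN (cs : CoxeterSystem (BCox n) W) (k : ℕ) : W :=
  if h : k < n then cs.simple ⟨k, h⟩ else 1

lemma sN_fin (cs : CoxeterSystem (BCox n) W) (i : Fin n) : sN cs i = cs.simple i := by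
  simp [sN]

lemma brel (cs : CoxeterSystem (BCox n) W) : BRel n (sN cs) := by
  have key : ∀ a b : ℕ, ∀ ha : a < n, ∀ hb : b < n, ∀ m, (BCox n).M ⟨a, ha⟩ ⟨b, hb⟩ = m →
      (sN cs a * sN cs b) ^ m = 1 := by
    intro a b ha hb m hm
    simp only [sN, ha, hb, dif_pos]
    rw [← hm]
    exact cs.simple_mul_simple_pow _ _
  have sq : ∀ k, k < n → sN cs k * sN cs k = 1 := by
    intro k hk
    simp [sN, hk]
  have inv : ∀ k, k < n → (sN cs k)⁻¹ = sN cs k := fun k hk => inv_eq_of_mul_eq_one_left (sq k hk)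
  refine ⟨sq, ?_, ?_, ?_⟩
  · intro j k hjk hk
    have := key j k (by omega) hk 2 (by
      simp only [BCox, Matrix.of_apply, Fin.mk.injEq]
      split_ifs <;> first | rfl | omega | simp_all)
    rw [pow_two] at this
    have := eq_inv_of_mul_eq_one_left this
    rwa [mul_inv_rev, inv _ hk, inv j (by omega)] at this
  · intro k h1 hk
    have := key k (k+1) (by omega) hk 3 (by
      simp only [BCox, Matrix.of_apply, Fin.mk.injEq]
      split_ifs <;> first | rfl | omega | simp_all)
    have : (sN cs k * sN cs (k+1) * sN cs k) * (sN cs (k+1) * sN cs k * sN cs (k+1)) = 1 := by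
      rw [← this]; simp only [pow_succ, pow_zero, mul_assoc, one_mul]
    have := eq_inv_of_mul_eq_one_left this
    simpa only [mul_inv_rev, inv _ hk, inv k (by omega), mul_assoc] using this
  · intro hn
    have := key 0 1 (by omega) hn 4 (by
      simp only [BCox, Matrix.of_apply, Fin.mk.injEq]
      split_ifs <;> first | rfl | omega | simp_all)
    have : (sN cs 0 * sN cs 1 * sN cs 0 * sN cs 1) * (sN cs 0 * sN cs 1 * sN cs 0 * sN cs 1) = 1 := by
      rw [← this]; simp only [pow_succ, pow_zero, mul_assoc, one_mul]
    have := eq_inv_of_mul_eq_one_left this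
    simpa only [mul_inv_rev, inv _ hn, inv 0 (by omega), mul_assoc] using this

def sig (i : ℕ) : Function.End (ℕ → ZMod 2) := fun v k =>
  if i = 0 then (if k = 0 then v 0 + 1 else v k)
  else if k + 1 = i then v i else if k = i then v (i - 1) else v k

lemma sig_liftable : (BCox n).IsLiftable (fun i : Fin n => sig (i : ℕ)) := by
  intro i j
  obtain ⟨i, hi⟩ := i
  obtain ⟨j, hj⟩ := j
  have h2 : ∀ a : ZMod 2, a + 1 + 1 = a := by decide
  have two : ∀ v, sig i (sig i v) = v := by
    intro v; funext k
    simp only [sig]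
    grind
  change (sig i * sig j) ^ ((BCox n).M ⟨i, hi⟩ ⟨j, hj⟩) = 1
  simp only [BCox, Matrix.of_apply, Fin.mk.injEq]
  split_ifs with h1 h3 h4
  · subst h1
    rw [pow_one]
    funext v
    exact two v
  · funext v
    change sig i (sig j (sig i (sig j (sig i (sig j (sig i (sig j v))))))) = v
    funext k
    have : (i = 0 ∧ j = 1) ∨ (i = 1 ∧ j = 0) := by omega
    rcases this with ⟨rfl, rfl⟩ | ⟨rfl, rfl⟩ <;>
    · rcases k with _ | _ | k <;> simp [sig, h2]
  · funext v
    change sig i (sig j (sig i (sig j (sig i (sig j v))))) = v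
    funext k
    rcases h4 with rfl | rfl
    · obtain ⟨j, rfl⟩ : ∃ t, j = t + 1 := ⟨j - 1, by omega⟩
      have q1 : ¬ (j = j + 1 + 1) := by omega
      have q2 : ¬ (j + 1 + 1 = j) := by omega
      by_cases k0 : k = j
      · simp [sig, k0, q1, q2]
      by_cases k1 : k = j + 1
      · simp [sig, k1, q1, q2]
      by_cases k2 : k = j + 2
      · simp [sig, k2, q1, q2]
      simp [sig, k0, k1, k2]
    · obtain ⟨i, rfl⟩ : ∃ t, i = t + 1 := ⟨i - 1, by omega⟩
      have q1 : ¬ (i = i + 1 + 1) := by omega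
      have q2 : ¬ (i + 1 + 1 = i) := by omega
      by_cases k0 : k = i
      · simp [sig, k0, q1, q2]
      by_cases k1 : k = i + 1
      · simp [sig, k1, q1, q2]
      by_cases k2 : k = i + 2
      · simp [sig, k2, q1, q2]
      simp [sig, k0, k1, k2]
  · funext v
    change sig i (sig j (sig i (sig j v))) = v
    funext k
    simp only [sig]
    grind

def phi (cs : CoxeterSystem (BCox n) W) : W →* Function.End (ℕ → ZMod 2) :=
  cs.lift ⟨_, sig_liftable⟩

lemma phi_simple (cs : CoxeterSystem (BCox n) W) (i : Fin n) : phi cs (cs.simple i) = sig i :=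
  cs.lift_apply_simple sig_liftable i

def tog (E : ℕ → ZMod 2) (i : ℕ) : ℕ → ZMod 2 := fun j => if j = i then E j + 1 else E j

def Vf (E : ℕ → ZMod 2) : ℕ → ZMod 2 := fun j => E j + E (j+1)

/-- Invariant: `x` is the canonical representative of the state given by `E`. -/
def InvSt (cs : CoxeterSystem (BCox n) W) (x : W) (E : ℕ → ZMod 2) : Prop :=
  x = XEl (sN cs) (Vf E) n ∧ phi cs x⁻¹ 0 = Vf E ∧ x ∈ IWset cs ∧ ∀ j, n ≤ j → E j = 0

lemma zmod2_add_self (a : ZMod 2) : a + a = 0 := by revert a; decide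

lemma Vf_ne (E : ℕ → ZMod 2) (i : ℕ) : Vf E i ≠ Vf E (i+1) ↔ E i + E (i+2) = 1 := by
  simp only [Vf]
  generalize E i = a
  generalize E (i+1) = b
  generalize E (i+2) = c
  revert a b c; decide

lemma Vf_tog_swap (E : ℕ → ZMod 2) (i : ℕ) (h : E i + E (i+2) = 1) :
    Vf (tog E (i+1)) i = Vf E (i+1) ∧ Vf (tog E (i+1)) (i+1) = Vf E i ∧
    ∀ j, j ≠ i → j ≠ i + 1 → Vf (tog E (i+1)) j = Vf E j := by
  refine ⟨?_, ?_, ?_⟩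
  · simp [Vf, tog]
    revert h
    generalize E i = a
    generalize E (i+1) = b
    generalize E (i+2) = c
    revert a b c; decide
  · simp [Vf, tog]
    revert h
    generalize E i = a
    generalize E (i+1) = b
    generalize E (i+2) = c
    revert a b c; decide
  · intro j h1 h2
    simp [Vf, tog, h1, h2]

lemma Vf_tog_flip (E : ℕ → ZMod 2) :
    Vf (tog E 0) 0 = Vf E 0 + 1 ∧ ∀ j, j ≠ 0 → Vf (tog E 0) j = Vf E j := by
  refine ⟨?_, ?_⟩
  · simp [Vf, tog]; ring
  · intro j h1
    simp [Vf, tog, h1]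

lemma XEl_zero (s : ℕ → W) (m : ℕ) : XEl s (Vf 0) m = 1 := by
  induction m with
  | zero => rfl
  | succ m ih => simp [XEl, ih, Vf]

lemma invSt_one (cs : CoxeterSystem (BCox n) W) : InvSt cs 1 0 := by
  refine ⟨(XEl_zero _ _).symm, ?_, ?_, fun _ _ => rfl⟩
  · simp only [inv_one, map_one]
    funext j; simp [Vf]; rfl
  · intro i _; simp

lemma inv_step (cs : CoxeterSystem (BCox n) W) (x : W) (E : ℕ → ZMod 2) (h : InvSt cs x E)
    (i : Fin n) (hP : x * cs.simple i ∈ IWset cs) :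
    (∀ k, (i : ℕ) = k + 1 → E k + E (k+2) = 1) ∧ InvSt cs (x * cs.simple i) (tog E i) := by
  obtain ⟨hx, hphi, hI, hE⟩ := h
  have h1 : ∀ k, (i : ℕ) = k + 1 → E k + E (k+2) = 1 := by
    intro k hk
    rw [← Vf_ne]
    intro hv
    obtain ⟨j, hj1, hj2, hj⟩ := XEl_fixed (brel cs) (Vf E) n k (by omega) le_rfl hv
    rw [← hx, ← hk, sN_fin] at hj
    have hj' : sN cs j = cs.simple ⟨j, hj2⟩ := sN_fin cs ⟨j, hj2⟩
    rw [hj'] at hj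
    rw [hj] at hP
    have a := hP ⟨j, hj2⟩ (by simp; omega)
    have b := hI ⟨j, hj2⟩ (by simp; omega)
    rw [cs.simple_mul_simple_cancel_left] at a
    omega
  refine ⟨h1, ?_, ?_, hP, ?_⟩
  · rw [← sN_fin]
    conv_lhs => rw [hx]
    rcases hi : (i : ℕ) with _ | k
    · have := Vf_tog_flip E
      exact XEl_flip (brel cs) _ _ n (by omega) le_rfl this.1 this.2
    · have h2 := h1 k hi
      have := Vf_tog_swap E k h2
      exact XEl_swap (brel cs) _ _ n k (by omega) le_rfl ((Vf_ne E k).2 h2) this.1 this.2.1 this.2.2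
  · rw [mul_inv_rev, map_mul, cs.inv_simple, phi_simple]
    change sig i (phi cs x⁻¹ 0) = _
    rw [hphi]
    rcases hi : (i : ℕ) with _ | k
    · have := Vf_tog_flip E
      funext j
      by_cases hj : j = 0
      · subst hj; rw [this.1]; simp [sig]
      · rw [this.2 j hj]; simp [sig, hj]
    · have := Vf_tog_swap E k (h1 k hi)
      funext j
      by_cases hj : j = k
      · subst hj; rw [this.1]; simp [sig]
      · by_cases hj' : j = k + 1
        · subst hj'; rw [this.2.1]; simp [sig]
        · rw [this.2.2 j hj hj']; simp [sig, hj, hj']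
  · intro j hj
    have := i.2
    rw [tog, if_neg (by omega), hE j hj]

/-- parity counts -/
def Ecnt : (ℕ → ZMod 2) → List (Fin n × Bool) → (ℕ → ZMod 2)
  | E, [] => E
  | E, (i, b) :: r => Ecnt (if b then tog E i else E) r

lemma Ecnt_append (l l' : List (Fin n × Bool)) (E : ℕ → ZMod 2) :
    Ecnt E (l ++ l') = Ecnt (Ecnt E l) l' := by
  induction l generalizing E with
  | nil => rfl
  | cons a l ih => obtain ⟨i, b⟩ := a; simp only [List.cons_append, Ecnt]; exact ih _

lemma subProdAux_append (cs : CoxeterSystem (BCox n) W) (l l' : List (Fin n × Bool)) (x : W) :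
    subProdAux cs x (l ++ l') = subProdAux cs (subProdAux cs x l) l' := by
  induction l generalizing x with
  | nil => rfl
  | cons a l ih => obtain ⟨i, b⟩ := a; simp only [List.cons_append, subProdAux]; exact ih _

lemma IsParAux_append (cs : CoxeterSystem (BCox n) W) (P : Set W) (l l' : List (Fin n × Bool)) (x : W) :
    IsParAux cs P x (l ++ l') ↔ IsParAux cs P x l ∧ IsParAux cs P (subProdAux cs x l) l' := by
  induction l generalizing x with
  | nil => simp [IsParAux, subProdAux]
  | cons a l ih =>
    obtain ⟨i, b⟩ := a
    simp only [List.cons_append, subProdAux, IsParAux, ih, and_assoc]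

lemma path_inv (cs : CoxeterSystem (BCox n) W) (l : List (Fin n × Bool)) (x : W) (E : ℕ → ZMod 2)
    (h : InvSt cs x E) (hp : IsParAux cs (IWset cs) x l) :
    InvSt cs (subProdAux cs x l) (Ecnt E l) := by
  induction l generalizing x E with
  | nil => exact h
  | cons a l ih =>
    obtain ⟨i, b⟩ := a
    obtain ⟨h1, h2⟩ := hp
    simp only [subProdAux, Ecnt]
    have := inv_step cs x E h i h1
    cases b
    · simp only [Bool.false_eq_true, if_false] at h2 ⊢
      exact ih _ _ h h2
    · simp only [if_true] at h2 ⊢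
      exact ih _ _ this.2 h2

lemma take_step (l : List (Fin n × Bool)) (p : ℕ) (hp : p < l.length) :
    l.take (p+1) = l.take p ++ [l[p]] := by simp

/-- At each time of a parabolic path: the invariant, and the constraint. -/
lemma path_time (cs : CoxeterSystem (BCox n) W) (l : List (Fin n × Bool))
    (hp : IsParAux cs (IWset cs) 1 l) (p : ℕ) :
    InvSt cs (subProdAux cs 1 (l.take p)) (Ecnt 0 (l.take p)) ∧
    ∀ h : p < l.length, ∀ k, (l[p].1 : ℕ) = k + 1 →
      Ecnt 0 (l.take p) k + Ecnt 0 (l.take p) (k+2) = 1 := by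
  have h1 : InvSt cs (subProdAux cs 1 (l.take p)) (Ecnt 0 (l.take p)) := by
    apply path_inv cs _ _ _ (invSt_one cs)
    rw [← List.take_append_drop p l, IsParAux_append] at hp
    exact hp.1
  refine ⟨h1, ?_⟩
  intro h k hk
  rw [← List.take_append_drop p l, IsParAux_append, List.drop_eq_getElem_cons h] at hp
  exact (inv_step cs _ _ h1 _ hp.2.1).1 k hk

lemma Ecnt_step (l : List (Fin n × Bool)) (p : ℕ) (h : p < l.length) :
    Ecnt 0 (l.take (p+1)) = if l[p].2 then tog (Ecnt 0 (l.take p)) l[p].1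
      else Ecnt 0 (l.take p) := by
  rw [take_step l p h, Ecnt_append]; rfl

lemma length_cEl (cs : CoxeterSystem (BCox n) W) (j : ℕ) : cs.length (cEl (sN cs) j) ≤ j + 1 := by
  have h1 : ∀ k, cs.length (sN cs k) ≤ 1 := by
    intro k; unfold sN; split_ifs <;> simp
  induction j with
  | zero => exact h1 0
  | succ j ih =>
    have := cs.length_mul_le (cEl (sN cs) j) (sN cs (j+1))
    have := h1 (j+1)
    simp only [cEl]; omega

lemma length_XEl (cs : CoxeterSystem (BCox n) W) (v : ℕ → ZMod 2) (m : ℕ) :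
    cs.length (XEl (sN cs) v m) ≤ NW v m := by
  induction m with
  | zero => simp [XEl]
  | succ m ih =>
    simp only [XEl, NW, Finset.sum_range_succ]
    have := cs.length_mul_le (if v m = 1 then cEl (sN cs) m else 1) (XEl (sN cs) v m)
    have h2 : cs.length (if v m = 1 then cEl (sN cs) m else 1) ≤ if v m = 1 then m + 1 else 0 := by
      split_ifs
      · exact length_cEl cs m
      · simp
    unfold NW at ih
    omega

/-- the full subexpression -/
def full (u : List (Fin n)) : List (Fin n × Bool) := u.map (fun i => (i, true))

lemma full_prod (cs : CoxeterSystem (BCox n) W) (u : List (Fin n)) (x : W) :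
    subProdAux cs x (full u) = x * cs.wordProd u := by
  induction u generalizing x with
  | nil => simp [full, subProdAux]
  | cons i u ih =>
    have := ih (x * cs.simple i)
    simp only [full, List.map_cons, subProdAux, if_true] at this ⊢
    rw [this, cs.wordProd_cons, mul_assoc]

lemma prefix_mem (cs : CoxeterSystem (BCox n) W) (u u' : List (Fin n))
    (hred : cs.IsReduced (u ++ u')) (hx : cs.wordProd (u ++ u') ∈ IWset cs) :
    cs.wordProd u ∈ IWset cs := by
  intro i hi
  have h1 := hx i hi
  rw [hred.eq, cs.wordProd_append, ← mul_assoc] at h1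
  have h2 := cs.length_mul_le (cs.simple i * cs.wordProd u) (cs.wordProd u')
  have h3 := cs.length_wordProd_le u
  have h4 := cs.length_wordProd_le u'
  rw [List.length_append] at h1
  omega

lemma full_par (cs : CoxeterSystem (BCox n) W) (u : List (Fin n)) (u0 : List (Fin n))
    (hred : cs.IsReduced (u0 ++ u)) (hx : cs.wordProd (u0 ++ u) ∈ IWset cs) :
    IsParAux cs (IWset cs) (cs.wordProd u0) (full u) := by
  induction u generalizing u0 with
  | nil => trivial
  | cons i u ih =>
    have e : u0 ++ i :: u = (u0 ++ [i]) ++ u := by simp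
    have e2 : cs.wordProd u0 * cs.simple i = cs.wordProd (u0 ++ [i]) := by
      rw [cs.wordProd_append, cs.wordProd_singleton]
    rw [e] at hred hx
    refine ⟨?_, ?_⟩
    · rw [e2]; exact prefix_mem cs _ _ hred hx
    · simp only [if_true]; rw [e2]; exact ih _ hred hx

lemma full_take (u : List (Fin n)) (p : ℕ) : (full u).take p = full (u.take p) := by
  simp [full]

/-- Along a reduced word of an element of `IWset`, every step is ascending. -/
lemma ascend (cs : CoxeterSystem (BCox n) W) (u : List (Fin n))
    (hred : cs.IsReduced u) (hx : cs.wordProd u ∈ IWset cs) (p : ℕ) (hp : p ≤ u.length) :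
    NW (Vf (Ecnt 0 (full (u.take p)))) n = p ∧
    ∀ h : p < u.length, Vf (Ecnt 0 (full (u.take p))) (u[p] : ℕ) = 0 ∧
      Vf (Ecnt 0 (full (u.take (p+1)))) (u[p] : ℕ) = 1 := by
  have hpar : IsParAux cs (IWset cs) 1 (full u) := by
    simpa using full_par cs u [] hred hx
  have hpt := path_time cs (full u) hpar
  have hlow : ∀ p, p ≤ u.length → p ≤ NW (Vf (Ecnt 0 (full (u.take p)))) n := by
    intro p hp
    have h1 := (hpt p).1.1
    rw [full_take, full_prod, one_mul] at h1
    have h2 := (hred.take p).eq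
    rw [h1, List.length_take, min_eq_left hp] at h2
    have := length_XEl cs (Vf (Ecnt 0 (full (u.take p)))) n
    omega
  have step : ∀ p, ∀ h : p < u.length, NW (Vf (Ecnt 0 (full (u.take p)))) n = p →
      (Vf (Ecnt 0 (full (u.take p))) (u[p] : ℕ) = 0 ∧
      Vf (Ecnt 0 (full (u.take (p+1)))) (u[p] : ℕ) = 1) ∧
      NW (Vf (Ecnt 0 (full (u.take (p+1))))) n = p + 1 := by
    intro p h hN
    have hl := hlow (p+1) h
    have hst := Ecnt_step (full u) p (by simpa [full] using h)
    have hco := (hpt p).2 (by simpa [full] using h)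
    rw [full_take, full_take] at hst
    rw [full_take] at hco
    have hget : (full u)[p]'(by simpa [full] using h) = (u[p], true) := by simp [full]
    rw [hget] at hst hco
    simp only [if_true] at hst
    simp only at hco
    rw [hst] at hl ⊢
    generalize Ecnt 0 (full (u.take p)) = E at *
    have hin := (u[p]).2
    generalize (u[p] : ℕ) = i at *
    rcases i with _ | k
    · have hf := Vf_tog_flip E
      rcases zmod2_cases (Vf E 0) with a | a
      · have hb : Vf (tog E 0) 0 = 1 := by rw [hf.1, a, zero_add]
        have := NW_flip (Vf (tog E 0)) (Vf E) n hin hb a (fun j hj => (hf.2 j hj).symm)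
        exact ⟨⟨a, hb⟩, by omega⟩
      · have hb : Vf (tog E 0) 0 = 0 := by rw [hf.1, a]; decide
        have := NW_flip (Vf E) (Vf (tog E 0)) n hin a hb hf.2
        omega
    · have hc := hco k rfl
      have hf := Vf_tog_swap E k hc
      have hne := (Vf_ne E k).2 hc
      rcases zmod2_cases (Vf E (k+1)) with a | a
      · have b : Vf E k = 1 := by
          rcases zmod2_cases (Vf E k) with b | b
          · rw [a, b] at hne; exact absurd rfl hne
          · exact b
        have := NW_swap (Vf (tog E (k+1))) (Vf E) n k hin (by rw [hf.1, a]) (by rw [hf.2.1, b]) b a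
          (fun j h1 h2 => (hf.2.2 j h1 h2).symm)
        exact ⟨⟨a, by rw [hf.2.1, b]⟩, by omega⟩
      · have b : Vf E k = 0 := by
          rcases zmod2_cases (Vf E k) with b | b
          · exact b
          · rw [a, b] at hne; exact absurd rfl hne
        have := NW_swap (Vf E) (Vf (tog E (k+1))) n k hin b a (by rw [hf.1, a]) (by rw [hf.2.1, b])
          hf.2.2
        omega
  have hN : ∀ p, p ≤ u.length → NW (Vf (Ecnt 0 (full (u.take p)))) n = p := by
    intro p
    induction p with
    | zero => intro _; simp [full, Ecnt, NW, Vf]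
    | succ p ih => intro h; exact (step p h (ih (by omega))).2
  exact ⟨hN p hp, fun h => (step p h (hN p hp)).1⟩

lemma between (cs : CoxeterSystem (BCox n) W) (u : List (Fin n))
    (hred : cs.IsReduced u) (hx : cs.wordProd u ∈ IWset cs) (p q i : ℕ) (hpq : p < q)
    (hq : q < u.length) (hpi : (u[p] : ℕ) = i) (hqi : (u[q] : ℕ) = i) :
    ∃ r, p < r ∧ ∃ h : r < q, (u[r] : ℕ) = i + 1 := by
  by_contra hcon
  push Not at hcon
  have key : ∀ r, p + 1 + r ≤ q → Vf (Ecnt 0 (full (u.take (p+1+r)))) i = 1 := by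
    intro r
    induction r with
    | zero =>
      intro _
      have := ((ascend cs u hred hx p (by omega)).2 (by omega)).2
      rwa [hpi] at this
    | succ r ih =>
      intro hr
      have h1 := ih (by omega)
      have h2 := ((ascend cs u hred hx (p+1+r) (by omega)).2 (by omega)).1
      have h3 := hcon (p+1+r) (by omega) (by omega)
      have hst := Ecnt_step (full u) (p+1+r) (by simp [full]; omega)
      rw [full_take, full_take] at hst
      have hget : (full u)[p+1+r]'(by simp [full]; omega) = (u[p+1+r], true) := by simp [full]
      rw [hget] at hst
      simp only [if_true] at hst
      have h4 : i ≠ (u[p+1+r] : ℕ) := by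
        intro h; rw [← h, h1] at h2; exact absurd h2 (by decide)
      rw [show p + 1 + (r + 1) = p + 1 + r + 1 by omega, hst, ← h1]
      simp only [Vf, tog]
      rw [if_neg h4, if_neg (fun h => h3 h.symm)]
  have h1 := key (q - (p+1)) (by omega)
  rw [show p + 1 + (q - (p+1)) = q by omega] at h1
  have h2 := ((ascend cs u hred hx q (by omega)).2 hq).1
  rw [hqi, h1] at h2
  exact absurd h2 (by decide)

lemma Vf_inj (E E' : ℕ → ZMod 2) (hE : ∀ j, n ≤ j → E j = 0) (hE' : ∀ j, n ≤ j → E' j = 0)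
    (h : Vf E = Vf E') (j : ℕ) : E j = E' j := by
  have : ∀ k j, n ≤ j + k → E j = E' j := by
    intro k
    induction k with
    | zero => intro j hj; rw [hE j hj, hE' j hj]
    | succ k ih =>
      intro j hj
      have h1 := congrFun h j
      simp only [Vf] at h1
      rw [ih (j+1) (by omega)] at h1
      exact add_right_cancel h1
  exact this n j (by omega)

end concretepart

/-- Let `x ∈ ᴵW`, let `u` be any reduced word for `x`, and let `y ∈ W`.
Then there is at most one `I`-parabolic subexpression of `u` whose product equals `y`. -/
theorem stmt_12 (n : ℕ) (hn : 2 ≤ n) {W : Type*} [Group W] (cs : CoxeterSystem (BCox n) W)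
    (x : W) (hx : x ∈ IWset cs)
    (u : List (Fin n)) (hred : cs.IsReduced u) (hprod : cs.wordProd u = x) (y : W) :
    ∀ e e' : List Bool, e.length = u.length → e'.length = u.length →
      IsPara cs (IWset cs) u e → IsPara cs (IWset cs) u e' →
      subProd cs u e = y → subProd cs u e' = y → e = e' := by
  intro e e' hl hl' hp hp' hy hy'
  subst hprod
  have lz : (u.zip e).length = u.length := by simp [hl]
  have lz' : (u.zip e').length = u.length := by simp [hl']
  have T := path_time cs _ hp
  have T' := path_time cs _ hp'
  let D : ℕ → ℕ → ZMod 2 := fun p j =>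
    Ecnt 0 ((u.zip e).take p) j - Ecnt 0 ((u.zip e').take p) j
  have hU : ∀ p (h : p < u.length), (if h : p < u.length then (u[p] : ℕ) else 0) = u[p] := by
    intro p h; simp [h]
  have hD : ∀ p, p ≤ u.length → ∀ j, D p j = 0 := by
    intro p hpm j
    refine comb n u.length (fun p => if h : p < u.length then (u[p] : ℕ) else 0) D ?_ ?_ ?_ ?_ ?_ ?_
      n j (by omega) p hpm <;> beta_reduce
    · intro p h; rw [hU p h]; exact (u[p]).2
    · intro j; simp [D, Ecnt]
    · intro j
      have a := (T u.length).1
      have b := (T' u.length).1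
      have hE := Vf_inj _ _ a.2.2.2 b.2.2.2 (by
        rw [← a.2.1, ← b.2.1]
        rw [List.take_of_length_le lz.le, List.take_of_length_le lz'.le]
        unfold subProd at hy hy'
        rw [hy, hy']) j
      simp only [D, hE, sub_self]
    · intro p h j hj
      rw [hU p h] at hj
      have a := Ecnt_step (u.zip e) p (by omega)
      have b := Ecnt_step (u.zip e') p (by omega)
      simp only [List.getElem_zip] at a b
      simp only [D, a, b]
      congr 1 <;> split_ifs <;> simp [tog, hj]
    · intro p h i hi
      rw [hU p h] at hi
      have a := (T p).2 (by omega) i (by simpa using hi)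
      have b := (T' p).2 (by omega) i (by simpa using hi)
      simp only [D]
      revert a b
      generalize Ecnt 0 ((u.zip e).take p) i = a1
      generalize Ecnt 0 ((u.zip e).take p) (i+2) = a2
      generalize Ecnt 0 ((u.zip e').take p) i = a3
      generalize Ecnt 0 ((u.zip e').take p) (i+2) = a4
      revert a1 a2 a3 a4; decide
    · intro p q i hpq hq h1 h2
      rw [hU p (by omega)] at h1
      rw [hU q hq] at h2
      obtain ⟨r, hr1, hr2, hr3⟩ := between cs u hred hx p q i hpq hq h1 h2
      exact ⟨r, hr1, hr2, by rw [hU r (by omega)]; exact hr3⟩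
  apply List.ext_getElem (by omega)
  intro p h1 h2
  have hpu : p < u.length := by omega
  have a := Ecnt_step (u.zip e) p (by omega)
  have b := Ecnt_step (u.zip e') p (by omega)
  simp only [List.getElem_zip] at a b
  have d0 := hD p hpu.le (u[p] : ℕ)
  have d1 := hD (p+1) hpu (u[p] : ℕ)
  simp only [D] at d0 d1
  rw [a, b] at d1
  have d0' := sub_eq_zero.1 d0
  cases he : e[p] <;> cases he' : e'[p] <;> simp [he, he', tog, d0'] at d1 ⊢
end
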